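/- Let $(W, S)$ be a Coxeter system with $W$ finite and $S = \{s_1, \ldots, s_n\}$ of cardinality $n \ge 1$, and assume the system is irreducible, i.e., $S$ cannot be partitioned into two nonempty subsets $S_1, S_2$ such that every element of $S_1$ commutes with every element of $S_2$. Let $\mathcal{R} = \{w s w^{-1} : w \in W, s \in S\}$ be the set of reflections of $W$, let $c$ be a Coxeter element (the product of all simple reflections, each occurring exactly once, in some order), and for $l \ge 0$ let $N_l = |\{(r_1,\ldots,r_l) \in \mathcal{R}^l : r_1 \cdots r_l = c\}|$. Then for every $t \in \mathbb{R}$, $\sum_{l=0}^{\infty} \frac{t^l}{l!} N_l = \frac{1}{|W|} \left( e^{t|\mathcal{R}|/n} - e^{-t|\mathcal{R}|/n} \right)^n$, the series on the left converging absolutely. -/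

import Mathlib

namespace CoxFac

section numbers
variable {B W : Type*} [Group W] {M : CoxeterMatrix B} (cs : CoxeterSystem M W)

/-- Edge weights. -/
noncomputable def wt (M : CoxeterMatrix B) (i j : B) : ℝ := 2 * Real.cos (Real.pi / (M i j : ℝ))

theorem wt_self (i : B) : wt M i i = -2 := by simp [wt]

theorem wt_comm (i j : B) : wt M i j = wt M j i := by simp [wt, M.symmetric i j]

theorem wt_two {i j : B} (h : M i j = 2) : wt M i j = 0 := by
  simp [wt, h]

theorem wt_ge_one {i j : B} (hij : i ≠ j) (h : M i j ≠ 2) : 1 ≤ wt M i j := by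
  have h1 : M i j ≠ 1 := M.off_diagonal i j hij
  rcases Nat.eq_zero_or_pos (M i j) with h0 | h0
  · simp [wt, h0]
  · have h3 : 3 ≤ M i j := by omega
    have h3' : (3:ℝ) ≤ M i j := by exact_mod_cast h3
    have : Real.cos (Real.pi / 3) ≤ Real.cos (Real.pi / (M i j : ℝ)) := by
      apply Real.cos_le_cos_of_nonneg_of_le_pi
      · positivity
      · linarith [Real.pi_pos]
      · gcongr
    rw [Real.cos_pi_div_three] at this
    unfold wt; linarith

theorem wt_nonneg {i j : B} (hij : i ≠ j) : 0 ≤ wt M i j := by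
  by_cases h : M i j = 2
  · rw [wt_two h]
  · linarith [wt_ge_one hij h]

/-- Firing a node in the numbers game. -/
noncomputable def act (M : CoxeterMatrix B) (i : B) : (B → ℝ) →ₗ[ℝ] (B → ℝ) where
  toFun f := fun j => f j + wt M i j * f i
  map_add' f g := by ext j; simp; ring
  map_smul' r f := by ext j; simp; ring

theorem act_apply (i : B) (f : B → ℝ) (j : B) : act M i f j = f j + wt M i j * f i := rfl

theorem act_self (i : B) (f : B → ℝ) : act M i f i = - f i := by
  rw [act_apply, wt_self]; ring

/-- Chebyshev-like sequence, shifted: `ch a 0 = -1, ch a 1 = 0, ch a 2 = 1`. -/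
def ch (a : ℝ) : ℕ → ℝ
  | 0 => -1
  | 1 => 0
  | (k+2) => a * ch a (k+1) - ch a k

theorem ch_sin (θ : ℝ) (k : ℕ) :
    Real.sin θ * ch (2 * Real.cos θ) k = Real.sin (((k:ℝ) - 1) * θ) := by
  induction k using Nat.strong_induction_on with
  | _ k ih =>
    match k with
    | 0 => simp [ch]
    | 1 => simp [ch]
    | (k+2) =>
      have h1 := ih (k+1) (by omega)
      have h0 := ih k (by omega)
      rw [ch]
      have e : Real.sin (((k+2:ℕ):ℝ) * θ - θ) + Real.sin (((k:ℝ) - 1) * θ) =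
        2 * Real.cos θ * Real.sin ((((k+1:ℕ):ℝ) - 1) * θ) := by
        have : ((k+2:ℕ):ℝ) * θ - θ = k * θ + θ := by push_cast; ring
        rw [this]
        have : ((k:ℝ) - 1) * θ = k * θ - θ := by ring
        rw [this]
        have : (((k+1:ℕ):ℝ) - 1) * θ = k * θ := by push_cast; ring
        rw [this, Real.sin_add, Real.sin_sub]; ring
      have e2 : (((k+2:ℕ):ℝ) - 1) * θ = ((k+2:ℕ):ℝ) * θ - θ := by ring
      rw [e2]
      linear_combination -e + 2 * Real.cos θ * h1 - h0

theorem ch_two (k : ℕ) : ch 2 k = (k:ℝ) - 1 := by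
  induction k using Nat.strong_induction_on with
  | _ k ih =>
    match k with
    | 0 => simp [ch]
    | 1 => simp [ch]
    | (k+2) =>
      rw [ch, ih (k+1) (by omega), ih k (by omega)]; push_cast; ring

theorem sin_pi_div_pos {m : ℕ} (hm : 2 ≤ m) : 0 < Real.sin (Real.pi / (m:ℝ)) := by
  have : (2:ℝ) ≤ m := by exact_mod_cast hm
  apply Real.sin_pos_of_pos_of_lt_pi
  · have := Real.pi_pos; positivity
  · apply div_lt_self Real.pi_pos; linarith

theorem ch_pos {i j : B} (hij : i ≠ j) {k : ℕ} (hk : 0 < k) (hkm : M i j = 0 ∨ k < M i j) :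
    0 < ch (wt M i j) (k+1) := by
  have h1 : M i j ≠ 1 := M.off_diagonal i j hij
  by_cases h0 : M i j = 0
  · have : wt M i j = 2 := by simp [wt, h0]
    rw [this, ch_two]; simp; exact_mod_cast hk
  · have hkm : k < M i j := by tauto
    have hs := sin_pi_div_pos (m := M i j) (by omega)
    have e := ch_sin (Real.pi / (M i j : ℝ)) (k+1)
    have hM : (0:ℝ) < M i j := by exact_mod_cast Nat.pos_of_ne_zero h0
    have : 0 < Real.sin ((((k+1:ℕ):ℝ) - 1) * (Real.pi / (M i j : ℝ))) := by
      have hk' : (0:ℝ) < k := by exact_mod_cast hk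
      have hkm' : (k:ℝ) < M i j := by exact_mod_cast hkm
      push_cast
      rw [add_sub_cancel_right]
      apply Real.sin_pos_of_pos_of_lt_pi
      · have := Real.pi_pos; positivity
      · rw [← mul_div_assoc, div_lt_iff₀ hM]
        nlinarith [Real.pi_pos]
    rw [← e] at this
    exact (pos_iff_pos_of_mul_pos this).mp hs

theorem ch_nonneg {i j : B} (hij : i ≠ j) {k : ℕ} (hk : 0 < k) (hkm : M i j = 0 ∨ k ≤ M i j) :
    0 ≤ ch (wt M i j) (k+1) := by
  by_cases h : M i j = 0 ∨ k < M i j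
  · exact (ch_pos hij hk h).le
  · have h1 : M i j ≠ 1 := M.off_diagonal i j hij
    have hkm' : k = M i j := by omega
    have h0 : M i j ≠ 0 := by omega
    have hs := sin_pi_div_pos (m := M i j) (by omega)
    have e := ch_sin (Real.pi / (M i j : ℝ)) (k+1)
    have hM : (M i j : ℝ) ≠ 0 := by exact_mod_cast h0
    have : Real.sin ((((k+1:ℕ):ℝ) - 1) * (Real.pi / (M i j : ℝ))) = 0 := by
      rw [hkm']; push_cast
      rw [add_sub_cancel_right, mul_div_cancel₀ _ hM, Real.sin_pi]
    rw [this] at e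
    rcases mul_eq_zero.mp e with h | h
    · exact absurd h hs.ne'
    · exact h.symm.le

/-- iterates of a product of two firings -/
theorem act_mul_act_pow (i j : B) (f : B → ℝ) (k : ℕ) :
    ∃ P Q : ℝ, (∀ l, ((act M i * act M j) ^ k) f l = f l + P * wt M j l + Q * wt M i l) ∧
      wt M i j * P = 2 * Q + (ch (wt M i j) 1 * f j + ch (wt M i j) 0 * f i)
        - (ch (wt M i j) (2*k+1) * f j + ch (wt M i j) (2*k) * f i) ∧
      wt M i j * Q = 2 * P + (ch (wt M i j) (2*k+2) * f j + ch (wt M i j) (2*k+1) * f i)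
        - (ch (wt M i j) 2 * f j + ch (wt M i j) 1 * f i) := by
  induction k with
  | zero => refine ⟨0, 0, ?_, ?_, ?_⟩ <;> simp
  | succ k ih =>
    obtain ⟨P, Q, h, h1, h2⟩ := ih
    set a := wt M i j with ha
    have r1 : ch a (2*k+2) = a * ch a (2*k+1) - ch a (2*k) := rfl
    have r2 : ch a (2*k+3) = a * ch a (2*k+2) - ch a (2*k+1) := rfl
    have r3 : ch a (2*k+4) = a * ch a (2*k+3) - ch a (2*k+2) := rfl
    have c0 : ch a 0 = -1 := rfl
    have c1 : ch a 1 = 0 := rfl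
    have c2 : ch a 2 = 1 := by simp [ch]
    refine ⟨P + (ch a (2*k+2) * f j + ch a (2*k+1) * f i),
      Q + (ch a (2*k+3) * f j + ch a (2*k+2) * f i), ?_, ?_, ?_⟩
    · intro l
      rw [pow_succ', Module.End.mul_apply, Module.End.mul_apply, act_apply, act_apply, act_apply,
        h l, h i, h j, wt_self, wt_self, wt_comm j i, ← ha]
      rw [c0, c1] at h1
      rw [c1, c2] at h2
      have X : f j + P * (-2) + Q * a = ch a (2*k+2) * f j + ch a (2*k+1) * f i := by linarith
      have Y : f i + P * a + Q * (-2) = -(ch a (2*k+1) * f j + ch a (2*k) * f i) := by linarith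
      rw [X, Y, r2, r1]; ring
    · rw [show 2*(k+1)+1 = 2*k+3 by ring, show 2*(k+1) = 2*k+2 by ring]
      rw [mul_add, h1, r2, r1]; ring
    · rw [show 2*(k+1)+2 = 2*k+4 by ring, show 2*(k+1)+1 = 2*k+3 by ring]
      rw [mul_add, h2, r3, r2, r1]; ring

theorem act_liftable : M.IsLiftable (act M) := by
  intro i j
  by_cases hij : i = j
  · subst hij
    rw [M.diagonal, pow_one]
    apply LinearMap.ext
    intro f
    funext l
    simp only [Module.End.mul_apply, LinearMap.comp_apply, act_apply, wt_self, Module.End.one_apply]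
    ring
  by_cases h0 : M i j = 0
  · rw [h0, pow_zero]
  have h1 : M i j ≠ 1 := M.off_diagonal i j hij
  apply LinearMap.ext
  intro f
  funext l
  obtain ⟨P, Q, h, hP, hQ⟩ := act_mul_act_pow (M := M) i j f (M i j)
  rw [h l]
  have hs := sin_pi_div_pos (m := M i j) (by omega)
  have hM : (M i j : ℝ) ≠ 0 := by exact_mod_cast h0
  have key : ∀ k, ch (wt M i j) (2 * M i j + k) = ch (wt M i j) k := by
    intro k
    have e := ch_sin (Real.pi / (M i j : ℝ)) (2 * M i j + k)
    have e' := ch_sin (Real.pi / (M i j : ℝ)) k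
    have : (((2 * M i j + k : ℕ):ℝ) - 1) * (Real.pi / (M i j : ℝ))
      = ((k:ℝ) - 1) * (Real.pi / (M i j : ℝ)) + 2 * Real.pi := by
      push_cast; field_simp; ring
    rw [this, Real.sin_add_two_pi, ← e'] at e
    exact mul_left_cancel₀ hs.ne' e
  have k0 := key 0
  rw [add_zero] at k0
  rw [key 1, k0] at hP
  rw [key 1, key 2] at hQ
  have hsq : wt M i j ^ 2 - 4 ≠ 0 := by
    have : wt M i j ^ 2 - 4 = -4 * Real.sin (Real.pi / (M i j : ℝ)) ^ 2 := by
      rw [Real.sin_sq, wt]; ring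
    rw [this]
    have := hs.ne'
    simp [this]
  have hP' : (wt M i j ^ 2 - 4) * P = 0 := by linear_combination wt M i j * hP + 2 * hQ
  have hQ' : (wt M i j ^ 2 - 4) * Q = 0 := by linear_combination 2 * hP + wt M i j * hQ
  have p0 : P = 0 := by simpa [hsq] using hP'
  have q0 : Q = 0 := by simpa [hsq] using hQ'
  simp [p0, q0]

/-- The (dual) reflection representation. -/
noncomputable def rep : W →* Module.End ℝ (B → ℝ) := cs.lift ⟨act M, act_liftable⟩

theorem rep_simple (i : B) : rep cs (cs.simple i) = act M i := cs.lift_apply_simple act_liftable i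

theorem rep_simple_mul (i : B) (w : W) (f : B → ℝ) (j : B) :
    rep cs (cs.simple i * w) f j = rep cs w f j + wt M i j * rep cs w f i := by
  rw [map_mul, Module.End.mul_apply, rep_simple, act_apply]

/-- alternating product -/
def alt (i j : B) : ℕ → W
  | 0 => 1
  | (k+1) => cs.simple i * alt j i k

theorem alt_even (i j : B) (k : ℕ) : alt cs i j (2*k) = (cs.simple i * cs.simple j) ^ k := by
  induction k with
  | zero => simp [alt]
  | succ k ih =>
    rw [show 2*(k+1) = 2*k+1+1 by ring, alt, alt, ih, pow_succ', mul_assoc]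

theorem alt_odd (i j : B) (k : ℕ) :
    alt cs i j (2*k+1) = (cs.simple i * cs.simple j) ^ k * cs.simple i := by
  induction k with
  | zero => simp [alt]
  | succ k ih =>
    rw [show 2*(k+1)+1 = 2*k+1+1+1 by ring, alt, alt, ih, pow_succ', mul_assoc, mul_assoc]

theorem alt_braid (i j : B) : alt cs i j (M i j) = alt cs j i (M i j) := by
  have h := cs.simple_mul_simple_pow i j
  have hinv : (cs.simple i * cs.simple j)⁻¹ = cs.simple j * cs.simple i := by simp
  rcases Nat.even_or_odd' (M i j) with ⟨k, hk | hk⟩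
  · rw [hk, alt_even, alt_even, ← hinv, inv_pow, eq_inv_iff_mul_eq_one, ← pow_add, ← two_mul, ← hk, h]
  · rw [hk, alt_odd, alt_odd, ← hinv, inv_pow]
    rw [hk] at h
    rw [eq_inv_mul_iff_mul_eq, ← mul_assoc, ← pow_add, ← eq_mul_inv_iff_mul_eq, cs.inv_simple,
      ← two_mul]
    rw [pow_succ, mul_eq_one_iff_eq_inv, hinv] at h
    exact h

theorem rep_alt (f : B → ℝ) (k : ℕ) : ∀ i j : B, 
    rep cs (alt cs j i k) f i = ch (wt M i j) (k+2) * (if Even k then f i else f j)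
      + ch (wt M i j) (k+1) * (if Even k then f j else f i) ∧
    rep cs (alt cs j i k) f j = -(ch (wt M i j) (k+1) * (if Even k then f i else f j)
      + ch (wt M i j) k * (if Even k then f j else f i)) := by
  induction k with
  | zero => intro i j; simp [alt, ch]
  | succ k ih =>
    intro i j
    obtain ⟨h1, h2⟩ := ih j i
    rw [wt_comm j i] at h1 h2
    rw [alt, rep_simple_mul, rep_simple_mul, h1, h2, wt_self, wt_comm j i]
    have r : ch (wt M i j) (k+1+2) = wt M i j * ch (wt M i j) (k+2) - ch (wt M i j) (k+1) := rfl
    have r' : ch (wt M i j) (k+2) = wt M i j * ch (wt M i j) (k+1) - ch (wt M i j) (k) := rfl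
    rw [r]
    by_cases hk : Even k
    · have hk' : ¬ Even (k+1) := by simpa [Nat.even_add_one] using hk
      simp only [hk, hk', if_true, if_false]
      constructor
      · rw [r']; ring
      · ring
    · have hk' : Even (k+1) := by simpa [Nat.even_add_one] using hk
      simp only [hk, hk', if_true, if_false]
      constructor
      · rw [r']; ring
      · ring

theorem exists_strip (l : ℕ) : ∀ (w : W) (i j : B), cs.length w = l → ¬ cs.IsLeftDescent w i →
    ∃ k w', w = alt cs j i k * w' ∧ cs.length w = k + cs.length w' ∧
      ¬ cs.IsLeftDescent w' i ∧ ¬ cs.IsLeftDescent w' j := by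
  induction l with
  | zero =>
    intro w i j hl hi
    refine ⟨0, w, by simp [alt], by simp, hi, ?_⟩
    rw [CoxeterSystem.IsLeftDescent, hl]; omega
  | succ l ih =>
    intro w i j hl hi
    by_cases hj : cs.IsLeftDescent w j
    · have hlen := cs.isLeftDescent_iff.mp hj
      obtain ⟨k, w', h1, h2, h3, h4⟩ := ih (cs.simple j * w) j i (by omega)
        (cs.isLeftDescent_iff_not_isLeftDescent_mul.mp hj)
      refine ⟨k+1, w', ?_, by omega, h4, h3⟩
      rw [alt, mul_assoc, ← h1, cs.simple_mul_simple_cancel_left]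
    · exact ⟨0, w, by simp [alt], by simp, hi, hj⟩

theorem alt_length_le (k : ℕ) : ∀ i j : B, cs.length (alt cs i j k) ≤ k := by
  induction k with
  | zero => intro i j; simp [alt]
  | succ k ih =>
    intro i j
    have := cs.length_mul_le (cs.simple i) (alt cs j i k)
    rw [cs.length_simple] at this
    rw [alt]; have := ih j i; omega

theorem alt_add (i j : B) (k l : ℕ) : ∃ i' j', alt cs i j (k+l) = alt cs i j k * alt cs i' j' l := by
  induction k generalizing i j with
  | zero => exact ⟨i, j, by simp [alt]⟩
  | succ k ih =>
    obtain ⟨i', j', h⟩ := ih j i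
    refine ⟨i', j', ?_⟩
    rw [show k+1+l = (k+l)+1 by ring, alt, alt, h, mul_assoc]

theorem rep_pos_aux (v : B → ℝ) (hv : ∀ j, 0 < v j) (l : ℕ) : ∀ (w : W) (i : B), cs.length w = l →
    ¬ cs.IsLeftDescent w i → 0 < rep cs w v i := by
  induction l using Nat.strong_induction_on with
  | _ l ih =>
    intro w i hl hi
    by_cases hw : w = 1
    · subst hw; simpa using hv i
    obtain ⟨j, hj⟩ := cs.exists_leftDescent_of_ne_one hw
    have hij : i ≠ j := by rintro rfl; exact hi hj
    obtain ⟨k, w', h1, h2, h3, h4⟩ := exists_strip cs l w i j hl hi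
    have hk : k ≠ 0 := by
      rintro rfl
      rw [alt, one_mul] at h1; subst h1; exact h4 hj
    have hi' := ih (cs.length w') (by omega) w' i rfl h3
    have hj' := ih (cs.length w') (by omega) w' j rfl h4
    have hkm : M i j = 0 ∨ k < M i j := by
      by_contra hcon
      push Not at hcon
      obtain ⟨hm0, hmk⟩ := hcon
      obtain ⟨r, rfl⟩ := Nat.exists_eq_add_of_le hmk
      obtain ⟨i', j', h⟩ := alt_add cs j i (M i j) r
      obtain ⟨m, hm⟩ := Nat.exists_eq_succ_of_ne_zero hm0
      apply hi
      have e : cs.simple i * w = alt cs j i m * (alt cs i' j' r * w') := by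
        rw [h1, h, ← alt_braid, hm, alt]
        simp [mul_assoc]
      have l1 := cs.length_mul_le (alt cs j i m) (alt cs i' j' r * w')
      have l2 := cs.length_mul_le (alt cs i' j' r) w'
      have l3 := alt_length_le cs m j i
      have l4 := alt_length_le cs r i' j'
      rw [CoxeterSystem.IsLeftDescent, e]
      omega
    have := (rep_alt cs (rep cs w' v) k i j).1
    rw [← Module.End.mul_apply, ← map_mul, ← h1] at this
    rw [this]
    have c1 : 0 ≤ ch (wt M i j) (k+1+1) := ch_nonneg hij (by omega) (by omega)
    have c2 : 0 < ch (wt M i j) (k+1) := ch_pos hij (by omega) hkm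
    apply add_pos_of_nonneg_of_pos
    · apply mul_nonneg c1; split_ifs <;> linarith
    · apply mul_pos c2; split_ifs <;> linarith

theorem rep_pos {v : B → ℝ} (hv : ∀ j, 0 < v j) {w : W} {i : B}
    (h : ¬ cs.IsLeftDescent w i) : 0 < rep cs w v i := rep_pos_aux cs v hv _ w i rfl h

theorem rep_neg {v : B → ℝ} (hv : ∀ j, 0 < v j) {w : W} {i : B}
    (h : cs.IsLeftDescent w i) : rep cs w v i < 0 := by
  have := rep_pos cs hv (cs.isLeftDescent_iff_not_isLeftDescent_mul.mp h)
  rw [rep_simple_mul, wt_self] at this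
  linarith

theorem rep_pos_iff {v : B → ℝ} (hv : ∀ j, 0 < v j) {w : W} {i : B} :
    0 < rep cs w v i ↔ ¬ cs.IsLeftDescent w i := by
  refine ⟨fun h h' => ?_, rep_pos cs hv⟩
  linarith [rep_neg cs hv h']

theorem rep_neg_iff {v : B → ℝ} (hv : ∀ j, 0 < v j) {w : W} {i : B} :
    rep cs w v i < 0 ↔ cs.IsLeftDescent w i := by
  refine ⟨fun h => ?_, rep_neg cs hv⟩
  by_contra h'
  linarith [rep_pos cs hv h']

theorem eq_one_of_no_descent {w : W} (h : ∀ i, ¬ cs.IsLeftDescent w i) : w = 1 := by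
  by_contra hw
  obtain ⟨i, hi⟩ := cs.exists_leftDescent_of_ne_one hw
  exact h i hi

end numbers
end CoxFac

namespace CoxFac

section exch
variable {B W : Type*} [Group W] {M : CoxeterMatrix B} (cs : CoxeterSystem M W)

theorem nonneg_of_eps {a b : ℝ} (h : ∀ ε : ℝ, 0 < ε → 0 ≤ a + ε * b) : 0 ≤ a := by
  by_contra ha
  push Not at ha
  have hb : 0 < 1 + |b| := by positivity
  have := h (-a / (2 * (1 + |b|))) (by apply div_pos <;> linarith)
  have h2 : -a / (2 * (1 + |b|)) * b ≤ -a / 2 := by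
    rw [div_mul_eq_mul_div, div_le_div_iff₀ (by positivity) (by norm_num)]
    nlinarith [le_abs_self b, mul_nonneg (neg_nonneg.mpr ha.le) (abs_nonneg b),
      mul_le_mul_of_nonneg_left (le_abs_self b) (neg_nonneg.mpr ha.le)]
  linarith

theorem functional_aux {w : W} {s t : B} (h1 : ¬ cs.IsLeftDescent w s)
    (h2 : cs.IsLeftDescent (w * cs.simple t) s) (v : B → ℝ) (hv : ∀ j, 0 ≤ v j) (ht : v t = 0) :
    rep cs w v s = 0 := by
  apply le_antisymm
  · have : 0 ≤ - rep cs w v s := by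
      apply nonneg_of_eps (b := - rep cs (w * cs.simple t) (fun _ => 1) s)
      intro ε hε
      have := rep_neg cs (v := v + ε • (fun _ => (1:ℝ))) (fun j => by
        have := hv j
        simp; linarith) h2
      rw [map_add, map_smul] at this
      have e : rep cs (w * cs.simple t) v = rep cs w v := by
        rw [map_mul, Module.End.mul_apply, rep_simple]
        congr 1
        funext j
        rw [act_apply, ht]; ring
      rw [e] at this
      simp only [Pi.add_apply, Pi.smul_apply, smul_eq_mul] at this
      linarith
    linarith
  · apply nonneg_of_eps (b := rep cs w (fun _ => 1) s)
    intro ε hε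
    have := rep_pos cs (v := v + ε • (fun _ => (1:ℝ))) (fun j => by
      have := hv j
      simp; linarith) h1
    rw [map_add, map_smul] at this
    simp at this
    linarith

theorem functional_aux2 {w : W} {s t : B} (h1 : ¬ cs.IsLeftDescent w s)
    (h2 : cs.IsLeftDescent (w * cs.simple t) s) :
    ∃ κ : ℝ, ∀ v : B → ℝ, rep cs w v s = v t * κ := by
  classical
  refine ⟨rep cs w (Pi.single t 1) s, fun v => ?_⟩
  have e : v = v t • Pi.single t (1:ℝ) + ((fun j => if j = t then 0 else max (v j) 0) -
      (fun j => if j = t then 0 else max (- v j) 0)) := by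
    funext j
    by_cases hj : j = t
    · subst hj; simp
    · simp only [Pi.add_apply, Pi.smul_apply, Pi.sub_apply, hj, if_false, smul_eq_mul]
      rw [Pi.single_eq_of_ne hj]
      rcases le_total 0 (v j) with h | h
      · rw [max_eq_left h, max_eq_right (by linarith)]; ring
      · rw [max_eq_right h, max_eq_left (by linarith)]; ring
  have a1 := functional_aux cs h1 h2 (fun j => if j = t then 0 else max (v j) 0)
    (fun j => by split_ifs <;> simp) (by simp)
  have a2 := functional_aux cs h1 h2 (fun j => if j = t then 0 else max (-v j) 0)
    (fun j => by split_ifs <;> simp) (by simp)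
  conv_lhs => rw [e]
  rw [map_add, map_sub, map_smul]
  simp only [Pi.add_apply, Pi.smul_apply, Pi.sub_apply, a1, a2, smul_eq_mul]
  ring

theorem not_descent_of_form {x : W} {j t : B} (hj : j ≠ t) (C : ℝ)
    (h : ∀ v : B → ℝ, rep cs x v j = v j + v t * C) : ¬ cs.IsLeftDescent x j := by
  classical
  have hpos : (0:ℝ) < 1 / (1 + |C|) := by positivity
  have hv : ∀ k, 0 < (fun k => if k = t then 1 / (1 + |C|) else (1:ℝ)) k := by
    intro k; simp only; split_ifs <;> first | exact hpos | norm_num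
  rw [← rep_pos_iff cs hv, h]
  simp only [hj, if_false, if_true]
  have : -(1:ℝ) < 1 / (1 + |C|) * C := by
    rw [div_mul_eq_mul_div, lt_div_iff₀ (by positivity)]
    linarith [neg_abs_le C]
  linarith

theorem exch {w : W} {s t : B} (h1 : ¬ cs.IsLeftDescent w s)
    (h2 : cs.IsLeftDescent (w * cs.simple t) s) : cs.simple s * w = w * cs.simple t := by
  obtain ⟨κ, hκ⟩ := functional_aux2 cs h1 h2
  set g : B → ℝ := rep cs w⁻¹ (fun j => wt M s j) with hg
  set y : W := w⁻¹ * (cs.simple s * w) with hy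
  have key : ∀ (v : B → ℝ) (j : B), rep cs y v j = v j + v t * (κ * g j) := by
    intro v j
    have : rep cs (cs.simple s * w) v = rep cs w v + (v t * κ) • (fun j => wt M s j) := by
      funext k
      rw [rep_simple_mul, hκ]; simp; ring
    rw [hy, map_mul, Module.End.mul_apply, this, map_add, map_smul, ← hg, ← Module.End.mul_apply,
      ← map_mul]
    simp; ring
  have hy1 : y ≠ 1 := by
    intro h
    rw [hy, inv_mul_eq_one] at h
    have : cs.simple s = 1 := by simpa using h.symm
    have h3 := cs.length_simple s
    rw [this, cs.length_one] at h3
    omega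
  have d1 : ∀ j, j ≠ t → ¬ cs.IsLeftDescent y j := fun j hj =>
    not_descent_of_form cs hj (κ * g j) (fun v => key v j)
  have dt : cs.IsLeftDescent y t := by
    by_contra hcon
    exact hy1 (eq_one_of_no_descent cs (fun j => by
      by_cases hj : j = t
      · subst hj; exact hcon
      · exact d1 j hj))
  have : cs.simple t * y = 1 := by
    apply eq_one_of_no_descent cs
    intro j
    by_cases hj : j = t
    · subst hj; exact cs.isLeftDescent_iff_not_isLeftDescent_mul.mp dt
    · apply not_descent_of_form cs hj (κ * g j + wt M t j * (1 + κ * g t))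
      intro v
      rw [rep_simple_mul, key, key]; ring
  have h3 : y = cs.simple t := by
    rw [mul_eq_one_iff_inv_eq, cs.inv_simple] at this
    exact this.symm
  rw [← h3, hy]; simp

theorem exch_iff {w : W} {s t : B} (h : cs.simple s * w ≠ w * cs.simple t) :
    cs.IsLeftDescent (w * cs.simple t) s ↔ cs.IsLeftDescent w s := by
  by_cases h1 : cs.IsLeftDescent w s <;> by_cases h2 : cs.IsLeftDescent (w * cs.simple t) s
  · simp [h1, h2]
  · exfalso
    apply h
    have := exch cs (w := w * cs.simple t) (t := t) h2 (by simpa using h1)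
    rw [cs.simple_mul_simple_cancel_right] at this
    rw [← this]
    simp
    exact this.symm
  · exact absurd (exch cs h1 h2) h
  · simp [h1, h2]

theorem exch_iff' {w : W} {s t : B} (h : cs.simple s * w ≠ w * cs.simple t) :
    cs.IsRightDescent (cs.simple s * w) t ↔ cs.IsRightDescent w t := by
  rw [← cs.isLeftDescent_inv_iff, ← cs.isLeftDescent_inv_iff, mul_inv_rev, cs.inv_simple]
  apply exch_iff
  intro h'
  apply h
  have := congrArg (·⁻¹) h'
  simp at this
  exact this.symm

/-- all simple reflections are descents -/
def IsTop (w : W) : Prop := ∀ i, cs.IsLeftDescent w i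

theorem IsTop.eq {w w' : W} (h : IsTop cs w) (h' : IsTop cs w') : w = w' := by
  have hv : ∀ j : B, (0:ℝ) < (fun _ => (1:ℝ)) j := fun _ => one_pos
  have hx : w' * w⁻¹ = 1 := by
    apply eq_one_of_no_descent cs
    intro i
    have hv' : ∀ j, 0 < (- rep cs w (fun _ => 1)) j := fun j => by
      have := rep_neg cs hv (h j); simp only [Pi.neg_apply]; linarith
    rw [← rep_pos_iff cs hv', map_neg, ← Module.End.mul_apply, ← map_mul, inv_mul_cancel_right]
    have := rep_neg cs hv (h' i)
    simp only [Pi.neg_apply]; linarith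
  rw [mul_inv_eq_one] at hx; exact hx.symm

theorem isTop_of_longest {w : W} (h : ∀ x, cs.length x ≤ cs.length w) : IsTop cs w := by
  intro i
  have h1 := h (cs.simple i * w)
  have h2 := cs.length_simple_mul_ne w i
  unfold CoxeterSystem.IsLeftDescent; omega

theorem exists_longest [Finite W] : ∃ w : W, ∀ x, cs.length x ≤ cs.length w :=
  Finite.exists_max _

theorem IsTop.longest [Finite W] {w : W} (h : IsTop cs w) (x : W) : cs.length x ≤ cs.length w := by
  obtain ⟨y, hy⟩ := exists_longest cs
  rw [h.eq cs (isTop_of_longest cs hy)]; exact hy x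

theorem IsTop.inv [Finite W] {w : W} (h : IsTop cs w) : w⁻¹ = w := by
  apply IsTop.eq cs _ h
  apply isTop_of_longest
  intro x; rw [cs.length_inv]; exact h.longest cs x

theorem IsTop.twist [Finite W] {w : W} (h : IsTop cs w) (t : B) :
    ∃ s, cs.simple s * w = w * cs.simple t := by
  have : ¬ IsTop cs (w * cs.simple t) := by
    intro h'
    have := h.eq cs h'
    have h3 : cs.simple t = 1 := by simpa using this.symm
    have h4 := cs.length_simple t
    rw [h3, cs.length_one] at h4
    omega
  unfold IsTop at this
  push Not at this
  obtain ⟨s, hs⟩ := this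
  refine ⟨s, ?_⟩
  have := exch cs (t := t) hs (by simpa using h s)
  rw [cs.simple_mul_simple_cancel_right, ← mul_assoc] at this
  rw [← this]; simp
  exact this

theorem mem_lis_aux (ω : List B) : ∀ (x : W) (s : B),
    ¬ (cs.IsLeftDescent x s ↔ cs.IsLeftDescent (x * cs.wordProd ω) s) →
    x⁻¹ * cs.simple s * x ∈ cs.leftInvSeq ω := by
  induction ω with
  | nil => intro x s h; simp at h
  | cons i ω ih =>
    intro x s h
    rw [CoxeterSystem.leftInvSeq]
    by_cases hx : cs.simple s * x = x * cs.simple i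
    · rw [mul_assoc, hx]; simp
    · have := exch_iff cs hx
      rw [← this, cs.wordProd_cons, ← mul_assoc] at h
      have := ih _ _ h
      apply List.mem_cons_of_mem
      rw [List.mem_map]
      refine ⟨_, this, ?_⟩
      simp [MulAut.conj_apply, mul_assoc]

theorem mem_lis_top [Finite W] {ω : List B} (h : IsTop cs (cs.wordProd ω)) {r : W} (hr : cs.IsReflection r) :
    r ∈ cs.leftInvSeq ω := by
  obtain ⟨y, s, rfl⟩ := hr
  have := mem_lis_aux cs ω y⁻¹ s ?_
  · simpa using this
  have hv : ∀ j : B, (0:ℝ) < (fun _ => (1:ℝ)) j := fun _ => one_pos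
  have hv' : ∀ j, 0 < (- rep cs (cs.wordProd ω) (fun _ => 1)) j := fun j => by
    have := rep_neg cs hv (h j); simp only [Pi.neg_apply]; linarith
  rw [← rep_neg_iff cs hv', ← rep_neg_iff cs hv, map_neg, ← Module.End.mul_apply, ← map_mul]
  simp only [Pi.neg_apply]
  have hne : rep cs (y⁻¹ * cs.wordProd ω) (fun _ => 1) s ≠ 0 := by
    by_cases hd : cs.IsLeftDescent (y⁻¹ * cs.wordProd ω) s
    · exact (rep_neg cs hv hd).ne
    · exact (rep_pos cs hv hd).ne'
  intro hiff
  rcases lt_or_gt_of_ne hne with h1 | h1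
  · have := hiff.mpr h1; linarith
  · have := hiff.mp (by linarith); linarith

end exch
end CoxFac

namespace CoxFac
set_option linter.unusedSectionVars false

section graph
variable {B W : Type*} [Group W] [Finite W] [Fintype B] [DecidableEq B]
  {M : CoxeterMatrix B}

theorem no_delta (cs : CoxeterSystem M W) (δ : B → ℝ) (h0 : ∀ i, 0 ≤ δ i) (i₀ : B) (hi : 0 < δ i₀)
    (h : ∀ t, 0 ≤ ∑ s, wt M t s * δ s) : False := by
  have hv : ∀ j : B, (0:ℝ) < (fun _ => (1:ℝ)) j := fun _ => one_pos
  obtain ⟨w0, hw0⟩ := exists_longest cs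
  have top := isTop_of_longest cs hw0
  have key : ∀ (l : ℕ) (w : W), cs.length w = l → 0 ≤ ∑ s, δ s * rep cs w (fun _ => 1) s := by
    intro l
    induction l with
    | zero =>
      intro w hw
      rw [cs.length_eq_zero_iff] at hw
      subst hw
      simp only [map_one, Module.End.one_apply, mul_one]
      exact Finset.sum_nonneg (fun i _ => h0 i)
    | succ l ih =>
      intro w hw
      have hw1 : w ≠ 1 := by rintro rfl; simp at hw
      obtain ⟨i, hi⟩ := cs.exists_leftDescent_of_ne_one hw1
      have hl := cs.isLeftDescent_iff.mp hi
      have := ih (cs.simple i * w) (by omega)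
      have hp := rep_pos cs hv (cs.isLeftDescent_iff_not_isLeftDescent_mul.mp hi)
      have e : w = cs.simple i * (cs.simple i * w) := by simp
      rw [e]
      simp only [rep_simple_mul cs i (cs.simple i * w)]
      have e2 : ∑ s, δ s * (rep cs (cs.simple i * w) (fun _ => 1) s +
          wt M i s * rep cs (cs.simple i * w) (fun _ => 1) i) =
          ∑ s, δ s * rep cs (cs.simple i * w) (fun _ => 1) s +
          (∑ s, wt M i s * δ s) * rep cs (cs.simple i * w) (fun _ => 1) i := by
        rw [Finset.sum_mul, ← Finset.sum_add_distrib]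
        apply Finset.sum_congr rfl
        intros; ring
      rw [e2]
      have := mul_nonneg (h i) hp.le
      linarith
  have := key _ w0 rfl
  have h2 : ∑ s, δ s * rep cs w0 (fun _ => 1) s < ∑ s : B, 0 := by
    apply Finset.sum_lt_sum
    · intro i _
      exact mul_nonpos_of_nonneg_of_nonpos (h0 i) (rep_neg cs hv (top i)).le
    · exact ⟨i₀, Finset.mem_univ _, mul_neg_of_pos_of_neg hi (rep_neg cs hv (top i₀))⟩
  simp at h2
  linarith

theorem exists_leaf (cs : CoxeterSystem M W) (U : Finset B) (hU : U.Nonempty) :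
    ∃ s ∈ U, ∃ t : B, ∀ u ∈ U, u ≠ s → u ≠ t → M s u = 2 := by
  by_contra hcon
  push Not at hcon
  obtain ⟨i₀, hi₀⟩ := hU
  apply no_delta cs (fun i => if i ∈ U then (1:ℝ) else 0) (fun i => by split_ifs <;> simp) i₀
    (by simp [hi₀])
  intro t
  simp only [mul_ite, mul_one, mul_zero, Finset.sum_ite_mem, Finset.univ_inter]
  by_cases ht : t ∈ U
  · obtain ⟨u, hu, hus, -, h1⟩ := hcon t ht t
    obtain ⟨u', hu', hus', huu, h1'⟩ := hcon t ht u
    have sub : ({t, u, u'} : Finset B) ⊆ U := by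
      intro x; simp; rintro (rfl | rfl | rfl) <;> assumption
    have : ∑ i ∈ ({t, u, u'} : Finset B), wt M t i ≤ ∑ i ∈ U, wt M t i := by
      apply Finset.sum_le_sum_of_subset_of_nonneg sub
      intro i _ hi
      apply wt_nonneg
      rintro rfl
      simp at hi
    rw [Finset.sum_insert (by simp; exact ⟨hus.symm, hus'.symm⟩),
      Finset.sum_insert (by simp; exact huu.symm), Finset.sum_singleton, wt_self] at this
    have := wt_ge_one (M := M) hus.symm h1
    have := wt_ge_one (M := M) hus'.symm h1'
    linarith
  · apply Finset.sum_nonneg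
    intro i hi
    apply wt_nonneg
    rintro rfl; exact ht hi

theorem exists_coloring (cs : CoxeterSystem M W) : ∃ col : B → Bool, ∀ i j, i ≠ j → col i = col j → M i j = 2 := by
  have key : ∀ (k : ℕ) (U : Finset B), U.card = k →
      ∃ col : B → Bool, ∀ i ∈ U, ∀ j ∈ U, i ≠ j → col i = col j → M i j = 2 := by
    intro k
    induction k with
    | zero =>
      intro U hU
      rw [Finset.card_eq_zero] at hU
      subst hU
      exact ⟨fun _ => true, by simp⟩
    | succ k ih =>
      intro U hU
      obtain ⟨s, hs, t, hst⟩ := exists_leaf cs U (Finset.card_pos.mp (by omega))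
      obtain ⟨col, hcol⟩ := ih (U.erase s) (by rw [Finset.card_erase_of_mem hs]; omega)
      refine ⟨Function.update col s (!(col t)), ?_⟩
      have aux : ∀ j ∈ U, j ≠ s → (!(col t)) = col j → M s j = 2 := by
        intro j hj hjs hc
        apply hst j hj hjs
        rintro rfl
        simp at hc
      intro i hi j hj hij hc
      by_cases his : i = s
      · subst his
        rw [Function.update_self, Function.update_of_ne hij.symm] at hc
        exact aux j hj hij.symm hc
      · by_cases hjs : j = s
        · subst hjs
          rw [Function.update_self, Function.update_of_ne hij] at hc
          rw [M.symmetric]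
          exact aux i hi hij hc.symm
        · rw [Function.update_of_ne his, Function.update_of_ne hjs] at hc
          exact hcol i (by simp [his, hi]) j (by simp [hjs, hj]) hij hc
  obtain ⟨col, hcol⟩ := key _ Finset.univ rfl
  exact ⟨col, fun i j => hcol i (Finset.mem_univ _) j (Finset.mem_univ _)⟩

theorem isConj_prod_rotate {G : Type*} [Group G] (a b : G) : IsConj (a * b) (b * a) := by
  rw [isConj_iff]; exact ⟨b, by group⟩

theorem simple_commute (cs : CoxeterSystem M W) {i j : B} (h : M i j = 2) : Commute (cs.simple i) (cs.simple j) := by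
  have := cs.simple_mul_simple_pow i j
  rw [h, pow_two] at this
  have h2 : cs.simple i * cs.simple j = (cs.simple i * cs.simple j)⁻¹ := by
    rw [eq_inv_iff_mul_eq_one]; exact this
  rw [mul_inv_rev, cs.inv_simple, cs.inv_simple] at h2
  exact h2

theorem conj_aux (cs : CoxeterSystem M W) (k : ℕ) : ∀ (U : Finset B) (f : B → W), U.card = k →
    (∀ i ∈ U, ∀ j ∈ U, M i j = 2 → Commute (f i) (f j)) →
    ∀ l l' : List B, l.Nodup → l'.Nodup → l.toFinset = U → l'.toFinset = U →
    IsConj (l.map f).prod (l'.map f).prod := by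
  induction k with
  | zero =>
    intro U f hU _ l l' _ _ hl hl'
    rw [Finset.card_eq_zero] at hU
    subst hU
    rw [List.toFinset_eq_empty_iff] at hl hl'
    subst hl hl'
    exact IsConj.refl _
  | succ k ih =>
    intro U f hU hf l l' hn hn' hl hl'
    obtain ⟨s, hs, t₀, hst₀⟩ := exists_leaf cs U (Finset.card_pos.mp (by omega))
    by_cases hUs : U.erase s = ∅
    · have : ∀ m : List B, m.Nodup → m.toFinset = U → m = [s] := by
        intro m hm hmU
        have hU' : U = {s} := by
          rw [Finset.erase_eq_empty_iff] at hUs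
          rcases hUs with h | h
          · rw [h] at hs; simp at hs
          · exact h
        have h1 : m.length = 1 := by
          rw [← List.toFinset_card_of_nodup hm, hmU, hU']; simp
        obtain ⟨a, rfl⟩ := List.length_eq_one_iff.mp h1
        rw [hU'] at hmU
        simpa using hmU
      rw [this l hn hl, this l' hn' hl']
    · obtain ⟨t, htU, hts, hst⟩ : ∃ t ∈ U, t ≠ s ∧ ∀ u ∈ U, u ≠ s → u ≠ t → M s u = 2 := by
        by_cases h : t₀ ∈ U ∧ t₀ ≠ s
        · exact ⟨t₀, h.1, h.2, hst₀⟩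
        · obtain ⟨t, ht⟩ := Finset.nonempty_iff_ne_empty.mpr hUs
          rw [Finset.mem_erase] at ht
          refine ⟨t, ht.2, ht.1, fun u hu hus _ => hst₀ u hu hus ?_⟩
          rintro rfl
          exact h ⟨hu, hus⟩
      set f' : B → W := Function.update f t (f s * f t) with hf'
      have hcs : ∀ u ∈ U, u ≠ s → u ≠ t → Commute (f s) (f u) := fun u hu hus hut =>
        hf s hs u hu (hst u hu hus hut)
      have step : ∀ m : List B, m.Nodup → m.toFinset = U →
          IsConj (m.map f).prod ((m.erase s).map f').prod := by
        intro m hm hmU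
        have hsm : s ∈ m := by rw [← List.mem_toFinset, hmU]; exact hs
        obtain ⟨x, y, rfl⟩ := List.append_of_mem hsm
        have hsx : s ∉ x := by
          intro h
          have := (List.nodup_append.mp hm).2.2 s h s (by simp)
          exact this rfl
        rw [List.erase_append_right _ hsx, List.erase_cons_head]
        have hn2 : (s :: (y ++ x)).Nodup := by
          have : (x ++ s :: y).Perm (s :: (y ++ x)) := by
            refine List.perm_append_comm.trans ?_
            simp
          exact this.nodup_iff.mp hm
        have hmem : ∀ u, u ∈ y ++ x → u ∈ U ∧ u ≠ s := by
          intro u hu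
          constructor
          · rw [← hmU]; simp at hu ⊢; tauto
          · rintro rfl
            exact (List.nodup_cons.mp hn2).1 hu
        have htm : t ∈ y ++ x := by
          rw [← hmU] at htU; simp at htU ⊢; tauto
        have c1 : IsConj ((x ++ s :: y).map f).prod (f s * ((y ++ x).map f).prod) := by
          have := isConj_prod_rotate (x.map f).prod ((s :: y).map f).prod
          simpa [mul_assoc] using this
        have c2 : IsConj (((y ++ x).map f').prod) (((x ++ y).map f').prod) := by
          have := isConj_prod_rotate (y.map f').prod (x.map f').prod
          simpa using this
        have e : f s * ((y ++ x).map f).prod = ((y ++ x).map f').prod := by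
          have hn3 : (y ++ x).Nodup := (List.nodup_cons.mp hn2).2
          clear c1 c2
          generalize y ++ x = z at *
          obtain ⟨p, r, rfl⟩ := List.append_of_mem htm
          have htp : t ∉ p := fun h => (List.nodup_append.mp hn3).2.2 t h t (by simp) rfl
          have htr : t ∉ r := (List.nodup_cons.mp (List.nodup_append.mp hn3).2.1).1
          have m1 : p.map f' = p.map f := by
            apply List.map_congr_left
            intro a ha
            rw [hf', Function.update_of_ne]
            rintro rfl; exact htp ha
          have m2 : r.map f' = r.map f := by
            apply List.map_congr_left
            intro a ha
            rw [hf', Function.update_of_ne]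
            rintro rfl; exact htr ha
          have cm : Commute (f s) (p.map f).prod := by
            apply Commute.list_prod_right
            intro a ha
            rw [List.mem_map] at ha
            obtain ⟨u, hu, rfl⟩ := ha
            have := hmem u (by simp [hu])
            apply hcs u this.1 this.2
            rintro rfl; exact htp hu
          simp only [List.map_append, List.map_cons, List.prod_append, List.prod_cons, m1, m2]
          rw [hf', Function.update_self, ← mul_assoc, cm.eq]
          simp [mul_assoc]
        exact c1.trans (e ▸ c2)
      refine (step l hn hl).trans (IsConj.trans ?_ (step l' hn' hl').symm)
      apply ih (U.erase s) f' (by rw [Finset.card_erase_of_mem hs]; omega)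
      · have aux : ∀ j ∈ U.erase s, M t j = 2 → j ≠ t → Commute (f s * f t) (f j) := by
          intro j hj h hjt
          rw [Finset.mem_erase] at hj
          exact (hcs j hj.2 hj.1 hjt).mul_left (hf t htU j hj.2 h)
        intro i hi j hj hij
        by_cases hit : i = t
        · by_cases hjt : j = t
          · rw [hit, hjt]
          · subst hit
            rw [hf', Function.update_self, Function.update_of_ne hjt]
            exact aux j hj hij hjt
        · by_cases hjt : j = t
          · subst hjt
            rw [hf', Function.update_self, Function.update_of_ne hit]
            exact (aux i hi (by rw [M.symmetric]; exact hij) hit).symm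
          · rw [hf', Function.update_of_ne hit, Function.update_of_ne hjt]
            exact hf i (Finset.mem_of_mem_erase hi) j (Finset.mem_of_mem_erase hj) hij
      · exact hn.erase _
      · exact hn'.erase _
      · ext a; rw [List.mem_toFinset, hn.mem_erase_iff, Finset.mem_erase, ← hl, List.mem_toFinset]
      · ext a; rw [List.mem_toFinset, hn'.mem_erase_iff, Finset.mem_erase, ← hl', List.mem_toFinset]

theorem coxeter_conj (cs : CoxeterSystem M W) (l l' : List B) (hn : l.Nodup) (hn' : l'.Nodup) (h : ∀ i, i ∈ l)
    (h' : ∀ i, i ∈ l') : IsConj (cs.wordProd l) (cs.wordProd l') := by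
  apply conj_aux cs _ Finset.univ cs.simple rfl
  · intro i _ j _ h; exact simple_commute cs h
  · exact hn
  · exact hn'
  · ext; simp [h]
  · ext; simp [h']

end graph

section PF

theorem exists_PF {B : Type*} [Fintype B] [Nonempty B] (a : B → B → ℝ)
    (hs : ∀ i j, a i j = a j i) (h0 : ∀ i j, 0 ≤ a i j)
    (hirr : ∀ P : Set B, P.Nonempty → Pᶜ.Nonempty → ∃ i ∈ P, ∃ j ∈ Pᶜ, a i j ≠ 0) :
    ∃ (p : B → ℝ) (lam : ℝ), (∀ i, 0 < p i) ∧ ∀ i, ∑ j, a i j * p j = lam * p i := by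
  classical
  set K : Set (B → ℝ) := {x | ∑ i, x i ^ 2 = 1} with hK
  have hKc : IsCompact K := by
    apply Metric.isCompact_of_isClosed_isBounded
    · exact isClosed_eq (by fun_prop) continuous_const
    · apply (Metric.isBounded_closedBall (x := (0 : B → ℝ)) (r := 1)).subset
      intro x hx
      rw [mem_closedBall_zero_iff, pi_norm_le_iff_of_nonneg (by norm_num)]
      intro i
      rw [Real.norm_eq_abs, ← sq_le_one_iff_abs_le_one, ← (show ∑ i, x i ^ 2 = 1 from hx)]
      exact Finset.single_le_sum (f := fun i => x i ^ 2) (fun i _ => sq_nonneg _) (Finset.mem_univ i)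
  set F : (B → ℝ) → ℝ := fun x => ∑ i, ∑ j, a i j * x i * x j with hF
  have hKn : K.Nonempty := by
    obtain ⟨b⟩ := ‹Nonempty B›
    refine ⟨Pi.single b 1, ?_⟩
    simp only [hK, Set.mem_ofPred_eq]
    rw [Finset.sum_eq_single b]
    · simp
    · intro c _ hc; simp [Pi.single_eq_of_ne hc]
    · simp
  obtain ⟨x, hx, hmax⟩ := hKc.exists_isMaxOn hKn (f := F) (by rw [hF]; fun_prop)
  set lam := F x with hlam
  have hle : ∀ y : B → ℝ, F y ≤ lam * ∑ i, y i ^ 2 := by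
    intro y
    set N := ∑ i, y i ^ 2 with hN
    have hN0 : 0 ≤ N := Finset.sum_nonneg (fun i _ => sq_nonneg _)
    rcases hN0.eq_or_lt with h | h
    · have : ∀ i, y i = 0 := by
        intro i
        have := (Finset.sum_eq_zero_iff_of_nonneg (fun i _ => sq_nonneg (y i))).mp h.symm i (Finset.mem_univ _)
        exact pow_eq_zero_iff (two_ne_zero) |>.mp this
      rw [← h]
      simp [hF, this]
    · have hsq := Real.sq_sqrt hN0
      have hsp := Real.sqrt_pos.mpr h
      have hmem : (fun i => y i / √N) ∈ K := by
        simp only [hK, Set.mem_ofPred_eq, div_pow, hsq]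
        rw [← Finset.sum_div, ← hN, div_self h.ne']
      have h3 : F (fun i => y i / √N) ≤ lam := hmax hmem
      have : F (fun i => y i / √N) = F y / N := by
        simp only [hF, Finset.sum_div]
        apply Finset.sum_congr rfl; intro i _
        apply Finset.sum_congr rfl; intro j _
        have h5 : a i j * (y i / √N) * (y j / √N) = a i j * y i * y j / (√N ^ 2) := by field_simp
        rw [h5, hsq]
      rw [this, div_le_iff₀ h] at h3
      exact h3
  set p : B → ℝ := fun i => |x i| with hp
  have hpN : ∑ i, p i ^ 2 = 1 := by simp only [hp, sq_abs]; exact hx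
  have hFp : F p = lam := by
    apply le_antisymm
    · have := hle p; rwa [hpN, mul_one] at this
    · rw [hlam]
      apply Finset.sum_le_sum; intro i _
      apply Finset.sum_le_sum; intro j _
      rw [mul_assoc, mul_assoc]
      apply mul_le_mul_of_nonneg_left _ (h0 i j)
      rw [hp]; simp only; rw [← abs_mul]; exact le_abs_self _
  have eig : ∀ i, ∑ j, a i j * p j = lam * p i := by
    intro i
    -- perturb in direction i
    have hpert : ∀ ε : ℝ, 0 ≤ 2 * ε * (lam * p i - ∑ j, a i j * p j) + ε^2 * (lam - a i i) := by
      intro ε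
      have h1 := hle (p + ε • (Pi.single i (1:ℝ) : B → ℝ) : B → ℝ)
      have e1 : ∑ k, (p + ε • (Pi.single i (1:ℝ) : B → ℝ) : B → ℝ) k ^ 2 = 1 + 2 * ε * p i + ε^2 := by
        have : ∀ k, (p + ε • (Pi.single i (1:ℝ) : B → ℝ) : B → ℝ) k ^ 2 = p k ^ 2 + (if k = i then 2 * ε * p k + ε^2 else 0) := by
          intro k
          simp only [Pi.add_apply, Pi.smul_apply, Pi.single_apply, smul_eq_mul]
          split_ifs <;> ring
        simp only [this, Finset.sum_add_distrib, hpN, Finset.sum_ite_eq', Finset.mem_univ, if_true]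
        ring
      have e2 : F (p + ε • (Pi.single i (1:ℝ) : B → ℝ) : B → ℝ) = lam + 2 * ε * (∑ j, a i j * p j) + ε^2 * a i i := by
        have : ∀ k j, a k j * (p + ε • (Pi.single i (1:ℝ) : B → ℝ) : B → ℝ) k * (p + ε • (Pi.single i (1:ℝ) : B → ℝ) : B → ℝ) j =
          a k j * p k * p j + (if k = i then ε * (a k j * p j) else 0) + (if j = i then ε * (a k j * p k) else 0)
            + (if k = i then (if j = i then ε^2 * a k j else 0) else 0) := by
          intro k j
          simp only [Pi.add_apply, Pi.smul_apply, Pi.single_apply, smul_eq_mul]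
          split_ifs <;> ring
        rw [← hFp]
        simp only [hF, this, Finset.sum_add_distrib]
        have s1 : ∑ k, ∑ j, (if k = i then ε * (a k j * p j) else 0) = ε * ∑ j, a i j * p j := by
          rw [Finset.sum_comm]; simp [Finset.mul_sum]
        have s2 : ∑ k, ∑ j, (if j = i then ε * (a k j * p k) else 0) = ε * ∑ j, a i j * p j := by
          simp only [Finset.sum_ite_eq', Finset.mem_univ, if_true, Finset.mul_sum]
          apply Finset.sum_congr rfl; intro k _; rw [hs]
        have s3 : ∑ k, ∑ j, (if k = i then (if j = i then ε^2 * a k j else 0) else 0) = ε^2 * a i i := by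
          rw [Finset.sum_comm]; simp
        rw [s1, s2, s3]; ring
      rw [e1, e2] at h1
      linarith
    set D := lam * p i - ∑ j, a i j * p j with hD
    have d1 : 0 ≤ D := by
      have : 0 ≤ 2 * D := nonneg_of_eps (b := lam - a i i) (fun ε hε => by
        have := hpert ε
        have h2 : 0 ≤ ε * (2 * D + ε * (lam - a i i)) := by linarith
        exact nonneg_of_mul_nonneg_right h2 hε)
      linarith
    have d2 : 0 ≤ -D := by
      have : 0 ≤ -(2 * D) := nonneg_of_eps (b := lam - a i i) (fun ε hε => by
        have := hpert (-ε)
        have h2 : 0 ≤ ε * (-(2 * D) + ε * (lam - a i i)) := by linarith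
        exact nonneg_of_mul_nonneg_right h2 hε)
      linarith
    linarith
  refine ⟨p, lam, ?_, eig⟩
  by_contra hcon
  push Not at hcon
  obtain ⟨i₁, hi₁⟩ := hcon
  have hp0 : ∀ i, 0 ≤ p i := fun i => abs_nonneg _
  have hPc : ({i | p i = 0} : Set B).Nonempty := ⟨i₁, le_antisymm hi₁ (hp0 i₁)⟩
  have hPn : ({i | p i = 0}ᶜ : Set B).Nonempty := by
    by_contra h
    rw [Set.not_nonempty_iff_eq_empty, Set.compl_empty_iff] at h
    have : ∀ i, p i = 0 := fun i => by
      have : i ∈ ({i | p i = 0} : Set B) := by rw [h]; trivial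
      exact this
    simp [this] at hpN
  obtain ⟨i, hi, j, hj, hij⟩ := hirr _ hPc hPn
  have e := eig i
  rw [show p i = 0 from hi, mul_zero] at e
  have := (Finset.sum_eq_zero_iff_of_nonneg (fun j _ => mul_nonneg (h0 i j) (hp0 j))).mp e j (Finset.mem_univ _)
  rcases mul_eq_zero.mp this with h | h
  · exact hij h
  · exact hj h

end PF
end CoxFac

namespace CoxFac
set_option linter.unusedSectionVars false
section altern
variable {B W : Type*} [Group W] {M : CoxeterMatrix B}

theorem rep_commuting (cs : CoxeterSystem M W) (l : List B) (hn : l.Nodup)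
    (hc : ∀ i ∈ l, ∀ j ∈ l, i ≠ j → M i j = 2) (w : W) (f : B → ℝ) (j : B) :
    rep cs (cs.wordProd l * w) f j =
      rep cs w f j + (l.map (fun s => wt M s j * rep cs w f s)).sum := by
  induction l generalizing j with
  | nil => simp
  | cons s l ih =>
    have ih' := ih (List.nodup_cons.mp hn).2
      (fun i hi j hj => hc i (List.mem_cons_of_mem _ hi) j (List.mem_cons_of_mem _ hj))
    rw [cs.wordProd_cons, mul_assoc, rep_simple_mul, ih', ih' s]
    have h0 : (l.map (fun s' => wt M s' s * rep cs w f s')).sum = 0 := by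
      apply List.sum_eq_zero
      intro x hx
      rw [List.mem_map] at hx
      obtain ⟨s', hs', rfl⟩ := hx
      rw [wt_two, zero_mul]
      apply hc s' (List.mem_cons_of_mem _ hs') s (by simp)
      rintro rfl
      exact (List.nodup_cons.mp hn).1 hs'
    rw [h0, List.map_cons, List.sum_cons]
    ring

theorem length_commuting (cs : CoxeterSystem M W) (l : List B) (hn : l.Nodup)
    (hc : ∀ i ∈ l, ∀ j ∈ l, i ≠ j → M i j = 2) (w : W)
    (hd : ∀ i ∈ l, ¬ cs.IsLeftDescent w i) :
    cs.length (cs.wordProd l * w) = l.length + cs.length w := by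
  induction l with
  | nil => simp
  | cons s l ih =>
    have hl : ∀ i ∈ l, ∀ j ∈ l, i ≠ j → M i j = 2 :=
      (fun i hi j hj => hc i (List.mem_cons_of_mem _ hi) j (List.mem_cons_of_mem _ hj))
    have ih' := ih (List.nodup_cons.mp hn).2 hl
      (fun i hi => hd i (List.mem_cons_of_mem _ hi))
    have hv : ∀ j : B, (0:ℝ) < (fun _ => (1:ℝ)) j := fun _ => one_pos
    have h1 := rep_commuting cs l (List.nodup_cons.mp hn).2 hl w (fun _ => 1) s
    have h0 : (l.map (fun s' => wt M s' s * rep cs w (fun _ => 1) s')).sum = 0 := by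
      apply List.sum_eq_zero
      intro x hx
      rw [List.mem_map] at hx
      obtain ⟨s', hs', rfl⟩ := hx
      rw [wt_two, zero_mul]
      apply hc s' (List.mem_cons_of_mem _ hs') s (by simp)
      rintro rfl
      exact (List.nodup_cons.mp hn).1 hs'
    rw [h0, add_zero] at h1
    have h2 := rep_pos cs hv (hd s (by simp))
    rw [← h1, rep_pos_iff cs hv] at h2
    have h3 := cs.not_isLeftDescent_iff.mp h2
    rw [cs.wordProd_cons, mul_assoc, h3, ih', List.length_cons]
    ring

/-- alternating words -/
def aw (L : Bool → List B) : Bool → ℕ → List B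
  | _, 0 => []
  | b, k + 1 => L b ++ aw L (!b) k

theorem aw_even (L : Bool → List B) (b : Bool) (k : ℕ) :
    aw L b (2 * k) = (List.replicate k (L b ++ L (!b))).flatten := by
  induction k with
  | zero => simp [aw]
  | succ k ih =>
    rw [show 2 * (k+1) = 2 * k + 1 + 1 by ring, aw, aw, Bool.not_not, ih, List.replicate_succ,
      List.flatten_cons, List.append_assoc]

theorem aw_add_odd (L : Bool → List B) (b : Bool) (k m : ℕ) :
    aw L b (2 * k + 1) ++ aw L (!b) m = aw L b (2 * k + 1 + m) := by
  induction k with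
  | zero => rw [show 2 * 0 + 1 + m = m + 1 by ring]; simp [aw]
  | succ k ih =>
    have e : ∀ (b : Bool) (j : ℕ), aw L b (j + 1 + 1) = L b ++ (L (!b) ++ aw L b j) := by
      intro b j; simp [aw]
    rw [show 2 * (k+1) + 1 = (2 * k + 1) + 1 + 1 by ring,
      show (2 * k + 1) + 1 + 1 + m = (2 * k + 1 + m) + 1 + 1 by ring, e, e, ← ih]
    simp

theorem exists_alternating [Finite W] [Fintype B] [DecidableEq B] [Nonempty B]
    (cs : CoxeterSystem M W)
    (hirr : ¬ ∃ P : Set B, P.Nonempty ∧ Pᶜ.Nonempty ∧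
      ∀ i ∈ P, ∀ j ∈ Pᶜ, Commute (cs.simple i) (cs.simple j)) :
    ∃ (l : List B) (h : ℕ) (ω ω' : List B), l.Nodup ∧ (∀ i, i ∈ l) ∧ 1 ≤ h ∧
      cs.IsReduced ω ∧ cs.IsReduced ω' ∧ IsTop cs (cs.wordProd ω) ∧ IsTop cs (cs.wordProd ω') ∧
      ω ++ ω' = (List.replicate h l).flatten := by
  obtain ⟨col, hcol⟩ := exists_coloring cs
  obtain ⟨p, lam, hp, hpe⟩ := exists_PF (fun i j => wt M i j + (if i = j then 2 else 0))
    (fun i j => by simp only [wt_comm i j, eq_comm])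
    (fun i j => by
      by_cases h : i = j
      · subst h; simp [wt_self]
      · simp [h, wt_nonneg h])
    (by
      intro P hP hPc
      by_contra hcon
      push Not at hcon
      refine hirr ⟨P, hP, hPc, fun i hi j hj => simple_commute cs ?_⟩
      have hij : i ≠ j := by rintro rfl; exact hj hi
      have := hcon i hi j hj
      rw [if_neg hij, add_zero] at this
      by_contra h2
      have := wt_ge_one hij h2
      linarith)
  have hpe' : ∀ i, ∑ j, wt M i j * p j = (lam - 2) * p i := by
    intro i
    have := hpe i
    simp only [add_mul, Finset.sum_add_distrib, ite_mul, zero_mul, Finset.sum_ite_eq,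
      Finset.mem_univ, if_true] at this
    linarith
  set L : Bool → List B := fun b => (Finset.univ.filter (fun i => col i = b)).toList with hL
  have memL : ∀ b i, i ∈ L b ↔ col i = b := by intro b i; simp [hL]
  have ndL : ∀ b, (L b).Nodup := fun b => Finset.nodup_toList _
  have cL : ∀ b, ∀ i ∈ L b, ∀ j ∈ L b, i ≠ j → M i j = 2 := by
    intro b i hi j hj hij
    rw [memL] at hi hj
    exact hcol i j hij (hi.trans hj.symm)
  -- shape
  have shape : ∀ (w : W) (b : Bool) (x : Bool → ℝ), (∀ i, rep cs w p i = x (col i) * p i) →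
      ∀ i, rep cs (cs.wordProd (L b) * w) p i =
        (if col i = b then - x b else x (!b) + lam * x b) * p i := by
    intro w b x hx i
    rw [rep_commuting cs (L b) (ndL b) (cL b)]
    have e1 : ((L b).map (fun s => wt M s i * rep cs w p s)).sum =
        ∑ s ∈ Finset.univ.filter (fun i => col i = b), wt M s i * rep cs w p s := by
      rw [hL]; exact Finset.sum_map_toList _ _
    have e2 : ∑ s ∈ Finset.univ.filter (fun i => col i = b), wt M s i * rep cs w p s =
        x b * ∑ s ∈ Finset.univ.filter (fun i => col i = b), wt M i s * p s := by
      rw [Finset.mul_sum]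
      apply Finset.sum_congr rfl
      intro s hs
      rw [Finset.mem_filter] at hs
      rw [hx, hs.2, wt_comm]; ring
    rw [e1, e2, hx]
    split_ifs with h
    · rw [Finset.sum_eq_single i, wt_self, h]
      · ring
      · intro j hj hji
        rw [Finset.mem_filter] at hj
        rw [wt_two (hcol i j hji.symm (h.trans hj.2.symm)), zero_mul]
      · intro hi; simp [h] at hi
    · have hci : col i = !b := by cases hh : col i <;> cases b <;> simp_all
      have e3 : ∑ s, wt M i s * p s = (∑ s ∈ Finset.univ.filter (fun i => col i = b), wt M i s * p s)
          + ∑ s ∈ Finset.univ.filter (fun i => ¬ col i = b), wt M i s * p s :=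
        (Finset.sum_filter_add_sum_filter_not _ _ _).symm
      have e4 : ∑ s ∈ Finset.univ.filter (fun i => ¬ col i = b), wt M i s * p s = -2 * p i := by
        rw [Finset.sum_eq_single i, wt_self]
        · intro j hj hji
          rw [Finset.mem_filter] at hj
          have hcj : col j = !b := by
            have := hj.2
            cases hh : col j <;> cases b <;> simp_all
          rw [wt_two (hcol i j hji.symm (hci.trans hcj.symm)), zero_mul]
        · intro hi; simp [h] at hi
      rw [hpe', e4] at e3
      rw [hci, show ∑ s ∈ Finset.univ.filter (fun i => col i = b), wt M i s * p s = lam * p i by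
        linarith]
      ring
  obtain ⟨w0, hw0⟩ := exists_longest cs
  have main : ∀ (m : ℕ) (b : Bool) (k : ℕ) (x : Bool → ℝ), cs.IsReduced (aw L b k) →
      (∀ i, rep cs (cs.wordProd (aw L b k)) p i = x (col i) * p i) →
      (∀ i, col i = b → cs.IsLeftDescent (cs.wordProd (aw L b k)) i) →
      cs.length w0 < m + cs.length (cs.wordProd (aw L b k)) →
      ∃ b' k', xor b' k'.bodd = xor b k.bodd ∧ cs.IsReduced (aw L b' k') ∧
        IsTop cs (cs.wordProd (aw L b' k')) := by
    intro m
    induction m with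
    | zero =>
      intro b k x _ _ _ h
      have := hw0 (cs.wordProd (aw L b k))
      omega
    | succ m ih =>
      intro b k x hr hx hd hlen
      by_cases htop : IsTop cs (cs.wordProd (aw L b k))
      · exact ⟨b, k, rfl, hr, htop⟩
      · have : ∃ i, ¬ cs.IsLeftDescent (cs.wordProd (aw L b k)) i := by
          by_contra h; push Not at h; exact htop h
        obtain ⟨i, hi⟩ := this
        have hci : col i = !b := by
          have : col i ≠ b := fun h => hi (hd i h)
          cases hh : col i <;> cases b <;> simp_all
        have hxp : 0 < x (!b) := by
          have := rep_pos cs hp hi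
          rw [hx, hci] at this
          exact pos_of_mul_pos_left this (hp i).le
        have hnd : ∀ j ∈ L (!b), ¬ cs.IsLeftDescent (cs.wordProd (aw L b k)) j := by
          intro j hj
          rw [memL] at hj
          rw [← rep_pos_iff cs hp, hx, hj]
          exact mul_pos hxp (hp j)
        have hlen2 := length_commuting cs (L (!b)) (ndL _) (cL _) _ hnd
        have haw : aw L (!b) (k+1) = L (!b) ++ aw L b k := by rw [aw, Bool.not_not]
        have hwp : cs.wordProd (aw L (!b) (k+1)) = cs.wordProd (L (!b)) * cs.wordProd (aw L b k) := by
          rw [haw, cs.wordProd_append]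
        have hsh := shape _ (!b) x hx
        rw [← hwp] at hsh hlen2
        have hLpos : 0 < (L (!b)).length := List.length_pos_of_mem ((memL _ i).mpr hci)
        obtain ⟨b', k', h1, h2⟩ := ih (!b) (k+1) (fun c => if c = !b then - x (!b) else x (!!b) + lam * x (!b))
          (by
            rw [CoxeterSystem.IsReduced, hlen2, haw, List.length_append, hr])
          hsh
          (by
            intro j hj
            rw [← rep_neg_iff cs hp, hsh, if_pos hj]
            nlinarith [mul_pos hxp (hp j)])
          (by omega)
        refine ⟨b', k', ?_, h2⟩
        rw [h1, Nat.bodd_succ]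
        cases b <;> cases k.bodd <;> rfl
  have start : ∀ c : Bool, ∃ b k, xor b k.bodd = c ∧ cs.IsReduced (aw L b k) ∧
        IsTop cs (cs.wordProd (aw L b k)) := by
    intro c
    have hl := length_commuting cs (L (!c)) (ndL _) (cL _) 1 (by
      intro i _ h
      rw [CoxeterSystem.IsLeftDescent] at h
      simp at h)
    have hsh := shape 1 (!c) (fun _ => 1) (by simp)
    have ha : aw L (!c) 1 = L (!c) := by simp [aw]
    obtain ⟨b, k, h1, h2⟩ := main (cs.length w0 + 1) (!c) 1 (fun d => if d = !c then - 1 else 1 + lam * 1)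
      (by rw [ha, CoxeterSystem.IsReduced]; simpa using hl)
      (by rw [ha]; simpa using hsh)
      (by
        intro i hi
        rw [← rep_neg_iff cs hp, ha, ← mul_one (cs.wordProd _), hsh, if_pos hi]
        linarith [hp i])
      (by omega)
    refine ⟨b, k, ?_, h2⟩
    rw [h1]; cases c <;> rfl
  have compl : ∀ b, (L b ++ L (!b)).Nodup ∧ ∀ i, i ∈ L b ++ L (!b) := by
    intro b
    constructor
    · rw [List.nodup_append]
      refine ⟨ndL _, ndL _, ?_⟩
      rintro i hi j hj rfl
      rw [memL] at hi hj
      rw [hi] at hj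
      cases b <;> simp at hj
    · intro i
      rw [List.mem_append, memL, memL]
      cases col i <;> cases b <;> simp
  have fin : ∀ b k (ω ω' : List B), cs.IsReduced ω → cs.IsReduced ω' → IsTop cs (cs.wordProd ω) →
      IsTop cs (cs.wordProd ω') → ω ++ ω' = aw L b (2 * k) →
    ∃ (l : List B) (h : ℕ) (ω ω' : List B), l.Nodup ∧ (∀ i, i ∈ l) ∧ 1 ≤ h ∧
      cs.IsReduced ω ∧ cs.IsReduced ω' ∧ IsTop cs (cs.wordProd ω) ∧ IsTop cs (cs.wordProd ω') ∧
      ω ++ ω' = (List.replicate h l).flatten := by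
    intro b k ω ω' h1 h2 h3 h4 h5
    refine ⟨L b ++ L (!b), k, ω, ω', (compl b).1, (compl b).2, ?_, h1, h2, h3, h4, h5.trans (aw_even L b k)⟩
    by_contra hk
    obtain rfl : k = 0 := by omega
    simp [aw] at h5
    obtain ⟨i⟩ := ‹Nonempty B›
    have := h3 i
    rw [h5.1, CoxeterSystem.IsLeftDescent] at this
    simp at this
  obtain ⟨b, k, hbk, hr, ht⟩ := start true
  obtain ⟨b', k', hbk', hr', ht'⟩ := start false
  rcases Nat.even_or_odd' k with ⟨m, rfl | rfl⟩
  · exact fin b (2 * m) _ _ hr hr ht ht (by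
      rw [aw_even, aw_even, ← List.flatten_append, ← List.replicate_add, two_mul])
  · rcases Nat.even_or_odd' k' with ⟨m', rfl | rfl⟩
    · exact fin b' (2 * m') _ _ hr' hr' ht' ht' (by
        rw [aw_even, aw_even, ← List.flatten_append, ← List.replicate_add, two_mul])
    · have hbb : b' = !b := by
        simp at hbk hbk'
        subst hbk hbk'; rfl
      subst hbb
      exact fin b (m + m' + 1) _ _ hr hr' ht ht' (by
        rw [aw_add_odd]; congr 1; ring)

theorem top_length [Finite W] (cs : CoxeterSystem M W) {ω : List B} (hr : cs.IsReduced ω)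
    (ht : IsTop cs (cs.wordProd ω)) : Nat.card {w : W // cs.IsReflection w} = ω.length := by
  classical
  have h1 := hr.nodup_leftInvSeq
  have : Nat.card {w : W // cs.IsReflection w} = (cs.leftInvSeq ω).toFinset.card := by
    rw [← Nat.card_eq_finsetCard]
    apply Nat.card_congr
    apply Equiv.subtypeEquivRight
    intro w
    rw [List.mem_toFinset]
    exact ⟨fun h => mem_lis_top cs ht h, fun h => cs.isReflection_of_mem_leftInvSeq ω h⟩
  rw [this, List.toFinset_card_of_nodup h1, cs.length_leftInvSeq]
end altern
end CoxFac

namespace CoxFac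
set_option linter.unusedSectionVars false
section hecke
variable {B W : Type*} [Group W] [Fintype W] [DecidableEq W] {M : CoxeterMatrix B}
  {K : Type*} [CommRing K]

open Classical in
/-- coefficient -/
noncomputable def ca (P : Prop) (q : K) : K := if P then 1 else q
open Classical in
/-- coefficient -/
noncomputable def cb (P : Prop) (q : K) : K := if P then q - 1 else 0

/-- Left multiplication by the Hecke generator. -/
noncomputable def Hs (cs : CoxeterSystem M W) (q : K) (s : B) : Matrix W W K := fun v w =>
  (if w = cs.simple s * v then ca (cs.IsLeftDescent v s) q else 0) +
  (if w = v then cb (cs.IsLeftDescent v s) q else 0)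

/-- Right multiplication by the Hecke generator. -/
noncomputable def Rs (cs : CoxeterSystem M W) (q : K) (s : B) : Matrix W W K := fun v w =>
  (if w = v * cs.simple s then ca (cs.IsRightDescent v s) q else 0) +
  (if w = v then cb (cs.IsRightDescent v s) q else 0)

theorem Hs_mul (cs : CoxeterSystem M W) (q : K) (s : B) (A : Matrix W W K) (v w : W) :
    (Hs cs q s * A) v w = ca (cs.IsLeftDescent v s) q * A (cs.simple s * v) w +
      cb (cs.IsLeftDescent v s) q * A v w := by
  simp [Matrix.mul_apply, Hs, add_mul, Finset.sum_add_distrib]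

theorem Rs_mul (cs : CoxeterSystem M W) (q : K) (s : B) (A : Matrix W W K) (v w : W) :
    (Rs cs q s * A) v w = ca (cs.IsRightDescent v s) q * A (v * cs.simple s) w +
      cb (cs.IsRightDescent v s) q * A v w := by
  simp [Matrix.mul_apply, Rs, add_mul, Finset.sum_add_distrib]

theorem Hs_Rs (cs : CoxeterSystem M W) (q : K) (s t : B) :
    Commute (Hs cs q s) (Rs cs q t) := by
  have : ∀ A : Matrix W W K, Hs cs q s * (Rs cs q t * A) = Rs cs q t * (Hs cs q s * A) := by
    intro A
    ext v w
    simp only [Hs_mul, Rs_mul]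
    by_cases h : cs.simple s * v = v * cs.simple t
    · have h1 : cs.IsLeftDescent v s ↔ cs.IsRightDescent v t := by
        simp only [CoxeterSystem.IsLeftDescent, CoxeterSystem.IsRightDescent, h]
      have h2 := cs.isLeftDescent_iff_not_isLeftDescent_mul (w := v) (i := s)
      have h3 := cs.isRightDescent_iff_not_isRightDescent_mul (w := v) (i := t)
      rw [← h] at h3 ⊢
      have e1 : cs.simple s * v * cs.simple t = v := by rw [h]; simp
      have e2 : cs.simple s * (cs.simple s * v) = v := by simp
      rw [e1, e2]
      by_cases hd : cs.IsLeftDescent v s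
      · have a1 := h1.mp hd
        have a2 := h2.mp hd
        have a3 := h3.mp a1
        simp only [ca, cb, hd, a1, a2, a3, if_true, if_false] <;> ring
      · have a1 := (not_congr h1).mp hd
        have a2 : cs.IsLeftDescent (cs.simple s * v) s := by tauto
        have a3 : cs.IsRightDescent (cs.simple s * v) t := by tauto
        simp only [ca, cb, hd, a1, a2, a3, if_true, if_false] <;> ring
    · rw [exch_iff cs h, exch_iff' cs h, mul_assoc]; ring
  have := this 1
  rw [mul_one, mul_one] at this
  exact this

/-- Operator of a word. -/
noncomputable def Hw (cs : CoxeterSystem M W) (q : K) (ω : List B) : Matrix W W K :=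
  (ω.map (Hs cs q)).prod

theorem Hw_cons (cs : CoxeterSystem M W) (q : K) (s : B) (ω : List B) :
    Hw cs q (s :: ω) = Hs cs q s * Hw cs q ω := by simp [Hw]

theorem Hw_append (cs : CoxeterSystem M W) (q : K) (ω ω' : List B) :
    Hw cs q (ω ++ ω') = Hw cs q ω * Hw cs q ω' := by simp [Hw]

theorem Hw_flatten (cs : CoxeterSystem M W) (q : K) (ω : List B) (h : ℕ) :
    Hw cs q (List.replicate h ω).flatten = Hw cs q ω ^ h := by
  induction h with
  | zero => simp [Hw]
  | succ h ih => rw [List.replicate_succ, List.flatten_cons, Hw_append, ih, pow_succ']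

theorem Hw_Rs (cs : CoxeterSystem M W) (q : K) (ω : List B) (t : B) :
    Commute (Hw cs q ω) (Rs cs q t) := by
  apply Commute.list_prod_left
  intro x hx
  rw [List.mem_map] at hx
  obtain ⟨s, _, rfl⟩ := hx
  exact Hs_Rs cs q s t

theorem eq_zero_of_col (cs : CoxeterSystem M W) (q : K) (D : Matrix W W K)
    (hD : ∀ t, Commute D (Rs cs q t)) (h1 : ∀ v, D v 1 = 0) : D = 0 := by
  have key : ∀ (l : ℕ) (w : W), cs.length w = l → ∀ v, D v w = 0 := by
    intro l
    induction l with
    | zero =>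
      intro w hw
      rw [cs.length_eq_zero_iff] at hw
      subst hw; exact h1
    | succ l ih =>
      intro w hw v
      have hw1 : w ≠ 1 := by rintro rfl; simp at hw
      obtain ⟨t, ht⟩ := cs.exists_rightDescent_of_ne_one hw1
      have hl := cs.isRightDescent_iff.mp ht
      have i1 := ih (w * cs.simple t) (by omega)
      have e1 := congrFun (congrFun (hD t).eq v) (w * cs.simple t)
      rw [Rs_mul, i1, i1, mul_zero, mul_zero, add_zero, Matrix.mul_apply] at e1
      have e2 : ∀ u, D v u * Rs cs q t u (w * cs.simple t) = if u = w then D v w else 0 := by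
        intro u
        simp only [Rs]
        by_cases hu : u = w
        · subst hu
          rw [if_pos rfl, if_pos rfl, if_neg]
          · simp [ca, ht]
          · intro h
            have h2 := cs.length_mul_simple_ne u t
            rw [h] at h2; exact h2 rfl
        · rw [if_neg (by intro h; exact hu (mul_right_cancel h).symm), if_neg hu]
          by_cases hu2 : w * cs.simple t = u
          · rw [← hu2, i1, zero_mul]
          · rw [if_neg hu2]; simp
      simp only [e2, Finset.sum_ite_eq', Finset.mem_univ, if_true] at e1
      exact e1
  ext v w
  exact key _ w rfl v

theorem Hw_col (cs : CoxeterSystem M W) (q : K) (ω : List B) (h : cs.IsReduced ω) (v : W) :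
    Hw cs q ω v 1 = if v = cs.wordProd ω then 1 else 0 := by
  induction ω generalizing v with
  | nil => simp [Hw, Matrix.one_apply]
  | cons s ω ih =>
    have hr : cs.IsReduced ω := h.drop 1
    have hnd : ¬ cs.IsLeftDescent (cs.wordProd ω) s := by
      rw [cs.not_isLeftDescent_iff, ← cs.wordProd_cons, h, hr]; rfl
    rw [Hw_cons, Hs_mul, ih hr, ih hr, cs.wordProd_cons]
    by_cases h1 : v = cs.simple s * cs.wordProd ω
    · have h2 : cs.IsLeftDescent v s := by
        rw [cs.isLeftDescent_iff_not_isLeftDescent_mul, h1]; simpa using hnd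
      have h3 : v ≠ cs.wordProd ω := by rintro h; rw [h] at h2; exact hnd h2
      rw [if_pos (by rw [h1]; simp), if_neg h3, if_pos h1]
      simp [ca, h2]
    · rw [if_neg (by intro h; apply h1; rw [← h]; simp), if_neg h1]
      split_ifs with h2
      · subst h2; simp [cb, hnd]
      · simp

theorem Hw_eq (cs : CoxeterSystem M W) (q : K) {ω ω' : List B} (h : cs.IsReduced ω)
    (h' : cs.IsReduced ω') (e : cs.wordProd ω = cs.wordProd ω') : Hw cs q ω = Hw cs q ω' := by
  rw [← sub_eq_zero]
  apply eq_zero_of_col cs q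
  · intro t; exact (Hw_Rs cs q ω t).sub_left (Hw_Rs cs q ω' t)
  · intro v; rw [Matrix.sub_apply, Hw_col cs q ω h, Hw_col cs q ω' h', e, sub_self]

theorem Hw_twist (cs : CoxeterSystem M W) (q : K) {ω : List B} (h : cs.IsReduced ω)
    (ht : IsTop cs (cs.wordProd ω)) {s t : B}
    (e : cs.simple s * cs.wordProd ω = cs.wordProd ω * cs.simple t) :
    Hs cs q s * Hw cs q ω = Hw cs q ω * Hs cs q t := by
  obtain ⟨τ, hτ, hτw⟩ := cs.exists_isReduced (cs.simple s * cs.wordProd ω)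
  have hl := cs.isLeftDescent_iff.mp (ht s)
  have hτl : τ.length + 1 = ω.length := by
    rw [← hτ.eq, ← h.eq, ← hτw]; exact hl
  have e1 : cs.wordProd (s :: τ) = cs.wordProd ω := by
    rw [cs.wordProd_cons, ← hτw]; simp
  have e2 : cs.wordProd (τ ++ [t]) = cs.wordProd ω := by
    rw [cs.wordProd_append, ← hτw, e]; simp
  have r1 : cs.IsReduced (s :: τ) := by
    rw [CoxeterSystem.IsReduced, e1, h.eq, List.length_cons, hτl]
  have r2 : cs.IsReduced (τ ++ [t]) := by
    rw [CoxeterSystem.IsReduced, e2, h.eq, List.length_append, ← hτl]; rfl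
  have f1 := Hw_eq cs q r1 h e1
  have f2 := Hw_eq cs q r2 h e2
  have e3 : Hw cs q [t] = Hs cs q t := by simp [Hw]
  rw [Hw_cons] at f1
  rw [Hw_append, e3] at f2
  calc Hs cs q s * Hw cs q ω = Hs cs q s * (Hw cs q τ * Hs cs q t) := by rw [f2]
    _ = Hw cs q ω * Hs cs q t := by rw [← mul_assoc, f1]

theorem Hw_central (cs : CoxeterSystem M W) (q : K) {ω : List B} (h : cs.IsReduced ω)
    (ht : IsTop cs (cs.wordProd ω)) (s : B) :
    Commute (Hw cs q ω * Hw cs q ω) (Hs cs q s) := by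
  obtain ⟨t, e⟩ := ht.twist cs s
  have e' : cs.simple s * cs.wordProd ω = cs.wordProd ω * cs.simple t := by
    have := congrArg (·⁻¹) e
    simp only [mul_inv_rev, cs.inv_simple, ht.inv] at this
    exact this.symm
  have f1 := Hw_twist cs q h ht e
  have f2 := Hw_twist cs q h ht e'
  show _ * _ = _ * _
  rw [mul_assoc, ← f1, ← mul_assoc, ← f2, mul_assoc]

theorem Hs_quad (cs : CoxeterSystem M W) (q : K) (s : B) :
    Hs cs q s * Hs cs q s = (q - 1) • Hs cs q s + q • 1 := by
  ext v w
  rw [← mul_one (Hs cs q s * Hs cs q s), mul_assoc, Matrix.add_apply, Matrix.smul_apply,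
    Matrix.smul_apply, Hs_mul, ← mul_one (Hs cs q s)]
  simp only [Hs_mul, mul_one]
  have h2 := cs.isLeftDescent_iff_not_isLeftDescent_mul (w := v) (i := s)
  rw [cs.simple_mul_simple_cancel_left]
  by_cases h : cs.IsLeftDescent v s
  · have a := h2.mp h
    simp only [ca, cb, h, a, if_true, if_false, smul_eq_mul]; ring
  · have a : cs.IsLeftDescent (cs.simple s * v) s := by tauto
    simp only [ca, cb, h, a, if_true, if_false, smul_eq_mul]; ring

theorem Hs_map {K' : Type*} [CommRing K'] (φ : K →+* K') (cs : CoxeterSystem M W) (q : K) (s : B) :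
    φ.mapMatrix (Hs cs q s) = Hs cs (φ q) s := by
  ext v w
  simp only [RingHom.mapMatrix_apply, Matrix.map_apply, Hs, ca, cb]
  split_ifs <;> simp

theorem Hw_map {K' : Type*} [CommRing K'] (φ : K →+* K') (cs : CoxeterSystem M W) (q : K)
    (ω : List B) : φ.mapMatrix (Hw cs q ω) = Hw cs (φ q) ω := by
  rw [Hw, Hw, map_list_prod, List.map_map]
  congr 1
  apply List.map_congr_left
  intro s _
  exact Hs_map φ cs q s

/-- support -/
theorem Hw_supp (cs : CoxeterSystem M W) (q : K) (ω : List B) (v w : W) (h : Hw cs q ω v w ≠ 0)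
    (f : B → ℝ) (hf : ∀ s ∈ ω, f s = 0) : rep cs v (rep cs w⁻¹ f) = f := by
  induction ω generalizing v with
  | nil =>
    simp only [Hw, List.map_nil, List.prod_nil, Matrix.one_apply] at h
    have : v = w := by by_contra h'; simp [h'] at h
    subst this
    rw [← Module.End.mul_apply, ← map_mul]; simp
  | cons s ω ih =>
    have hf' : ∀ s ∈ ω, f s = 0 := fun s hs => hf s (List.mem_cons_of_mem _ hs)
    rw [Hw_cons, Hs_mul] at h
    by_cases h1 : Hw cs q ω v w = 0
    · by_cases h2 : Hw cs q ω (cs.simple s * v) w = 0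
      · simp [h1, h2] at h
      · have := ih _ h2 hf'
        have e : v = cs.simple s * (cs.simple s * v) := by simp
        rw [e]
        ext j
        rw [rep_simple_mul, this, hf s (by simp), mul_zero, add_zero]
    · exact ih _ h1 hf'

theorem Hw_diag (cs : CoxeterSystem M W) (q : K) (ω : List B) (hn : ω.Nodup) (w : W) :
    Hw cs q ω w w = (ω.map (fun s => cb (cs.IsLeftDescent w s) q)).prod := by
  classical
  induction ω with
  | nil => simp [Hw]
  | cons s ω ih =>
    have hs := (List.nodup_cons.mp hn).1
    rw [Hw_cons, Hs_mul, ih (List.nodup_cons.mp hn).2, List.map_cons, List.prod_cons]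
    have : Hw cs q ω (cs.simple s * w) w = 0 := by
      by_contra h
      have h1 := Hw_supp cs q ω _ _ h (Pi.single s 1) (by
        intro s' hs'
        rw [Pi.single_eq_of_ne]
        rintro rfl; exact hs hs')
      have h2 := congrFun h1 s
      rw [rep_simple_mul, ← Module.End.mul_apply, ← map_mul, wt_self] at h2
      simp at h2
    rw [this, mul_zero, zero_add]

theorem Hw_trace (cs : CoxeterSystem M W) (q : K) (ω : List B) (hn : ω.Nodup) (ha : ∀ i, i ∈ ω) :
    (Hw cs q ω).trace = (q - 1) ^ ω.length := by
  obtain ⟨w0, hw0⟩ := exists_longest cs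
  have top := isTop_of_longest cs hw0
  rw [Matrix.trace, Finset.sum_eq_single w0]
  · rw [Matrix.diag_apply, Hw_diag cs q ω hn]
    have : ω.map (fun s => cb (cs.IsLeftDescent w0 s) q) = List.replicate ω.length (q - 1) := by
      rw [List.eq_replicate_iff]
      refine ⟨by simp, ?_⟩
      intro b hb
      rw [List.mem_map] at hb
      obtain ⟨s, _, rfl⟩ := hb
      simp [cb, top s]
    rw [this, List.prod_replicate]
  · intro w _ hw
    rw [Matrix.diag_apply, Hw_diag cs q ω hn]
    have : ∃ i, ¬ cs.IsLeftDescent w i := by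
      by_contra h; push Not at h
      exact hw (IsTop.eq cs h top)
    obtain ⟨i, hi⟩ := this
    apply List.prod_eq_zero
    rw [List.mem_map]
    exact ⟨i, ha i, by simp [cb, hi]⟩
  · simp

end hecke
end CoxFac

namespace CoxFac
set_option linter.unusedSectionVars false
section spectral
open Polynomial

theorem det_aeval {n : Type*} [Fintype n] [DecidableEq n] (A : Matrix n n ℂ) (p : ℂ[X]) :
    (aeval A p).det = (A.charpoly.roots.map (fun r => p.eval r)).prod := by
  have hcard : Multiset.card A.charpoly.roots = Fintype.card n := by
    rw [← (IsAlgClosed.splits A.charpoly).natDegree_eq_card_roots, Matrix.charpoly_natDegree_eq_dim]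
  have hlin : ∀ a : ℂ, (aeval A (X - C a)).det = (A.charpoly.roots.map (fun r => (X - C a).eval r)).prod := by
    intro a
    have h1 : A.charpoly.eval a = (A.charpoly.roots.map (fun r => a - r)).prod := by
      conv_lhs => rw [(IsAlgClosed.splits A.charpoly).eq_prod_roots_of_monic A.charpoly_monic]
      rw [eval_multiset_prod, Multiset.map_map]
      simp
    have h2 : (aeval A (X - C a)).det = (-1) ^ Fintype.card n * A.charpoly.eval a := by
      rw [Matrix.eval_charpoly, ← Matrix.det_neg]
      simp [Matrix.scalar_apply, Matrix.algebraMap_eq_diagonal]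
      rfl
    rw [h2, h1, ← hcard]
    generalize A.charpoly.roots = s
    induction s using Multiset.induction_on with
    | empty => simp
    | cons b s ih =>
      rw [Multiset.map_cons, Multiset.prod_cons, Multiset.map_cons, Multiset.prod_cons, ← ih,
        Multiset.card_cons]
      simp only [eval_sub, eval_X, eval_C]
      ring
  have hsp := (IsAlgClosed.splits p).eq_prod_roots
  rw [hsp]
  generalize p.leadingCoeff = c
  generalize p.roots = s
  induction s using Multiset.induction_on with
  | empty =>
    simp [Matrix.algebraMap_eq_diagonal, hcard]
  | cons a s ih =>
    rw [Multiset.map_cons, Multiset.prod_cons, mul_left_comm, map_mul, Matrix.det_mul, ih, hlin,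
      ← Multiset.prod_map_mul]
    simp only [eval_mul]

theorem roots_charpoly_pow {n : Type*} [Fintype n] [DecidableEq n] (A : Matrix n n ℂ) (j : ℕ) :
    (A ^ j).charpoly.roots = A.charpoly.roots.map (fun r => r ^ j) := by
  have : (A ^ j).charpoly = ((A.charpoly.roots.map (fun r => r ^ j)).map (fun a => X - C a)).prod := by
    apply Polynomial.funext
    intro z
    have h := det_aeval A (C z - X ^ j)
    rw [Matrix.eval_charpoly, eval_multiset_prod, Multiset.map_map, Multiset.map_map]
    simp only [Function.comp_def, eval_sub, eval_X, eval_C, eval_pow] at h ⊢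
    rw [← h]
    simp [Matrix.algebraMap_eq_diagonal, Matrix.scalar_apply]
    rfl
  rw [this, roots_multiset_prod_X_sub_C]

theorem trace_pow_eq {n : Type*} [Fintype n] [DecidableEq n] (A : Matrix n n ℂ) (j : ℕ) :
    (A ^ j).trace = (A.charpoly.roots.map (fun r => r ^ j)).sum := by
  rw [Matrix.trace_eq_sum_roots_charpoly, roots_charpoly_pow]

theorem det_quad {E : Type*} [AddCommGroup E] [Module ℂ E] [FiniteDimensional ℂ E]
    (f : Module.End ℂ E) (q : ℂ) (hf : f * f = (q - 1) • f + q • 1) :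
    ∃ k ≤ Module.finrank ℂ E, (LinearMap.det f) ^ 2 = q ^ (2 * k) := by
  rw [Module.End.det_eq_prod_roots_charpoly_of_splits (IsAlgClosed.splits _)]
  have hcard : Multiset.card f.charpoly.roots = Module.finrank ℂ E := by
    rw [← (IsAlgClosed.splits f.charpoly).natDegree_eq_card_roots, LinearMap.charpoly_natDegree]
  have hroot : ∀ r ∈ f.charpoly.roots, r = -1 ∨ r = q := by
    intro r hr
    have hr' : f.charpoly.IsRoot r := isRoot_of_mem_roots hr
    rw [← Module.End.hasEigenvalue_iff_isRoot_charpoly] at hr'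
    obtain ⟨v, hv⟩ := hr'.exists_hasEigenvector
    have h1 := congrArg (fun g => g v) hf
    simp only [Module.End.mul_apply, LinearMap.add_apply, LinearMap.smul_apply, Module.End.one_apply,
      hv.apply_eq_smul, map_smul, smul_smul, ← add_smul] at h1
    rw [← sub_eq_zero, ← sub_smul, smul_eq_zero, or_iff_left hv.2] at h1
    have : (r + 1) * (r - q) = 0 := by linear_combination h1
    rcases mul_eq_zero.mp this with h | h
    · left; linear_combination h
    · right; linear_combination h
  rw [← hcard]
  generalize f.charpoly.roots = s at hroot
  induction s using Multiset.induction_on with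
  | empty => exact ⟨0, by simp⟩
  | cons a s ih =>
    obtain ⟨k, hk, e⟩ := ih (fun r hr => hroot r (Multiset.mem_cons_of_mem hr))
    rw [Multiset.prod_cons, mul_pow, e, Multiset.card_cons]
    rcases hroot a (Multiset.mem_cons_self _ _) with rfl | rfl
    · exact ⟨k, by omega, by simp⟩
    · exact ⟨k + 1, by omega, by ring⟩

theorem det_restrict_list {V : Type*} [AddCommGroup V] [Module ℂ V] [FiniteDimensional ℂ V]
    (E : Submodule ℂ V) (q : ℂ) (L : List (Module.End ℂ V))
    (h1 : ∀ f ∈ L, f * f = (q - 1) • f + q • 1) (h2 : ∀ f ∈ L, ∀ x ∈ E, f x ∈ E) :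
    ∃ (hE : ∀ x ∈ E, L.prod x ∈ E), ∃ k ≤ Module.finrank ℂ E * L.length,
      (LinearMap.det (L.prod.restrict hE)) ^ 2 = q ^ (2 * k) := by
  induction L with
  | nil =>
    refine ⟨by simp, 0, by simp, ?_⟩
    have : ((([] : List (Module.End ℂ V)).prod).restrict (p := E) (q := E) (by simp)) = 1 := by
      ext x; simp
    rw [this]; simp
  | cons f L ih =>
    obtain ⟨hE, k, hk, e⟩ := ih (fun g hg => h1 g (List.mem_cons_of_mem _ hg))
      (fun g hg => h2 g (List.mem_cons_of_mem _ hg))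
    have hfE := h2 f (by simp)
    obtain ⟨k', hk', e'⟩ := det_quad (f.restrict hfE) q (by
      ext x
      have := congrArg (fun g => g (x : V)) (h1 f (by simp))
      simpa using this)
    refine ⟨?_, k' + k, ?_, ?_⟩
    · intro x hx; rw [List.prod_cons]; exact hfE _ (hE x hx)
    · rw [List.length_cons]; nlinarith
    · have : (List.prod (f :: L)).restrict (p := E) (q := E) (by intro x hx; rw [List.prod_cons]; exact hfE _ (hE x hx)) =
          (f.restrict hfE) * (L.prod.restrict hE) := by
        ext x; simp
      rw [this, map_mul, mul_pow, e, e']; ring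

theorem eig_pow {V : Type*} [AddCommGroup V] [Module ℂ V] [FiniteDimensional ℂ V]
    (q : ℂ) (L : List (Module.End ℂ V)) (h1 : ∀ f ∈ L, f * f = (q - 1) • f + q • 1)
    (h2 : ∀ f ∈ L, Commute L.prod f) (lam : ℂ) (hl : L.prod.HasEigenvalue lam) :
    ∃ d, 1 ≤ d ∧ d ≤ Module.finrank ℂ V ∧ ∃ k ≤ d * L.length, lam ^ (2 * d) = q ^ (2 * k) := by
  set E := L.prod.eigenspace lam with hE
  obtain ⟨hE', k, hk, e⟩ := det_restrict_list E q L h1 (by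
    intro f hf x hx
    rw [hE, Module.End.mem_eigenspace_iff] at hx ⊢
    have := congrArg (fun g => g x) (h2 f hf).eq
    simp only [Module.End.mul_apply] at this
    rw [this, hx, map_smul])
  refine ⟨Module.finrank ℂ E, ?_, Submodule.finrank_le _, k, hk, ?_⟩
  · have : E ≠ ⊥ := hl
    rw [Nat.one_le_iff_ne_zero]
    intro h
    exact this (Submodule.finrank_eq_zero.mp h)
  · rw [← e]
    have : L.prod.restrict hE' = lam • 1 := by
      ext x
      have := Module.End.mem_eigenspace_iff.mp x.2
      simpa using this
    rw [this, LinearMap.det_smul, map_one, mul_one, ← pow_mul, mul_comm]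

end spectral
end CoxFac

namespace CoxFac
set_option linter.unusedSectionVars false
section tr
open Polynomial
variable {B W : Type*} [Group W] [Fintype W] [DecidableEq W] {M : CoxeterMatrix B}

theorem map_tr {R S : Type*} [CommRing R] [CommRing S] (φ : R →+* S) (A : Matrix W W R) :
    φ A.trace = (φ.mapMatrix A).trace := by
  simp [Matrix.trace]

theorem root_pow (cs : CoxeterSystem M W) {l ω ω' : List B} {h : ℕ}
    (hr : cs.IsReduced ω) (hr' : cs.IsReduced ω') (ht : IsTop cs (cs.wordProd ω))
    (ht' : IsTop cs (cs.wordProd ω')) (he : ω ++ ω' = (List.replicate h l).flatten)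
    (q μ : ℂ) (hμ : μ ∈ (Hw cs q l).charpoly.roots) :
    ∃ K ≤ 2 * (ω ++ ω').length * (Fintype.card W).factorial,
      μ ^ (h * (2 * (Fintype.card W).factorial)) = q ^ K := by
  set φ : Matrix W W ℂ ≃ₐ[ℂ] Module.End ℂ (W → ℂ) := Matrix.toLinAlgEquiv' with hφ
  set L : List (Module.End ℂ (W → ℂ)) := (ω ++ ω').map (fun s => φ (Hs cs q s)) with hL
  have hLp : L.prod = φ (Hw cs q (ω ++ ω')) := by
    rw [hL, Hw, map_list_prod, List.map_map]; rfl
  have hLp2 : L.prod = φ (Hw cs q l) ^ h := by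
    rw [hLp, he, Hw_flatten, map_pow]
  have hμ1 : (φ (Hw cs q l)).HasEigenvalue μ := by
    rw [Module.End.hasEigenvalue_iff_mem_spectrum, AlgEquiv.spectrum_eq,
      Matrix.mem_spectrum_iff_isRoot_charpoly]
    exact isRoot_of_mem_roots hμ
  have hμ2 := hμ1.pow h
  rw [← hLp2] at hμ2
  obtain ⟨d, hd1, hd2, k, hk, e⟩ := eig_pow q L
    (by
      intro f hf
      rw [hL, List.mem_map] at hf
      obtain ⟨s, _, rfl⟩ := hf
      rw [← map_mul, Hs_quad, map_add, map_smul, map_smul, map_one])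
    (by
      intro f hf
      have hf' := hf
      rw [hL, List.mem_map] at hf'
      obtain ⟨s, _, rfl⟩ := hf'
      have e1 : Hw cs q (ω ++ ω') = Hw cs q ω * Hw cs q ω := by
        rw [Hw_append, Hw_eq cs q hr' hr (ht'.eq cs ht)]
      have := Hw_central cs q hr ht s
      rw [← e1] at this
      rw [hLp]
      exact this.map φ)
    _ hμ2
  have hfr : Module.finrank ℂ (W → ℂ) = Fintype.card W := Module.finrank_fintype_fun_eq_card ℂ
  rw [hfr] at hd2
  obtain ⟨e', he'⟩ := Nat.dvd_factorial hd1 hd2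
  have hlen : L.length = (ω ++ ω').length := by rw [hL, List.length_map]
  rw [hlen] at hk
  refine ⟨2 * k * e', ?_, ?_⟩
  · rw [he']
    calc 2 * k * e' ≤ 2 * (d * (ω ++ ω').length) * e' := by gcongr
      _ = _ := by ring
  · rw [he', show h * (2 * (d * e')) = h * (2 * d) * e' by ring, pow_mul, pow_mul μ h, e, ← pow_mul]

theorem trace_formula (cs : CoxeterSystem M W) {l ω ω' : List B} {h : ℕ} (hh : 1 ≤ h)
    (hn : l.Nodup) (ha : ∀ i, i ∈ l)
    (hr : cs.IsReduced ω) (hr' : cs.IsReduced ω') (ht : IsTop cs (cs.wordProd ω))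
    (ht' : IsTop cs (cs.wordProd ω')) (he : ω ++ ω' = (List.replicate h l).flatten) :
    ∃ m0, 1 ≤ m0 ∧ ∀ (m : ℕ) (q : ℝ), (Hw cs q l ^ (1 + h * m0 * m)).trace =
      (q ^ (1 + h * m0 * m) - 1) ^ l.length := by
  set N := Fintype.card W with hN
  set m0 := 2 * N.factorial with hm0
  have hm01 : 1 ≤ m0 := by have := N.factorial_pos; omega
  set Mm := h * m0 with hMm
  have hMm1 : 0 < Mm := Nat.mul_pos hh hm01
  set Kx := 2 * (ω ++ ω').length * N.factorial with hKx
  refine ⟨m0, hm01, ?_⟩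
  let T := (nthRootsFinset Mm (1:ℂ)) × Fin (Kx + 1)
  let g : ℕ → T → ℂ := fun x t => (t.1 : ℂ) * (x : ℂ) ^ (t.2 : ℕ)
  have hT : ∀ t : T, (t.1 : ℂ) ^ Mm = 1 := fun t => (mem_nthRootsFinset hMm1 _).mp t.1.2
  have ex : ∀ x : ℕ, ∃ s : Sym T N,
      (Hw cs (((x + 1 : ℕ) : ℂ) ^ Mm) l).charpoly.roots = (s : Multiset T).map (g (x + 1)) := by
    intro x
    set R := (Hw cs (((x + 1 : ℕ) : ℂ) ^ Mm) l).charpoly.roots with hR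
    have hx0 : ((x + 1 : ℕ) : ℂ) ≠ 0 := by exact_mod_cast Nat.succ_ne_zero x
    have h1 : ∀ r : ℂ, ∃ t : T, r ∈ R → r = g (x + 1) t := by
      intro r
      by_cases hrR : r ∈ R
      · obtain ⟨K, hK, e⟩ := root_pow cs hr hr' ht ht' he _ r hrR
        refine ⟨(⟨r / ((x + 1 : ℕ) : ℂ) ^ K, ?_⟩, ⟨K, Nat.lt_succ_of_le hK⟩), fun _ => ?_⟩
        · rw [mem_nthRootsFinset hMm1, div_pow]
          have : r ^ Mm = (((x + 1 : ℕ) : ℂ) ^ K) ^ Mm := by rw [e, ← pow_mul, ← pow_mul, mul_comm]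
          rw [this, div_self (pow_ne_zero _ (pow_ne_zero _ hx0))]
        · simp only [g]
          rw [div_mul_cancel₀ _ (pow_ne_zero _ hx0)]
      · exact ⟨(⟨1, by rw [mem_nthRootsFinset hMm1, one_pow]⟩, 0), fun h => absurd h hrR⟩
    choose t ht using h1
    have hcard : Multiset.card R = N := by
      rw [hR, ← (IsAlgClosed.splits _).natDegree_eq_card_roots, Matrix.charpoly_natDegree_eq_dim]
    refine ⟨⟨R.map t, by rw [Multiset.card_map, hcard]⟩, ?_⟩
    show R = (R.map t).map (g (x + 1))
    rw [Multiset.map_map]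
    conv_lhs => rw [← Multiset.map_id R]
    exact Multiset.map_congr rfl (fun r hr => ht r hr)
  choose S hS using ex
  obtain ⟨s, hs⟩ := Finite.exists_infinite_fiber S
  have hinf : (S ⁻¹' {s}).Infinite := Set.infinite_coe_iff.mp hs
  have tr : ∀ x ∈ S ⁻¹' {s}, ∀ j, (Hw cs (((x + 1 : ℕ) : ℂ) ^ Mm) l ^ j).trace =
      ((s : Multiset T).map (fun t => g (x + 1) t ^ j)).sum := by
    intro x hx j
    have : S x = s := hx
    rw [trace_pow_eq, hS, this, Multiset.map_map]; rfl
  -- polynomial identity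
  let P : ℂ[X] := ((s : Multiset T).map (fun t => C (t.1 : ℂ) * X ^ (t.2 : ℕ))).sum
  have hPe : ∀ z : ℂ, P.eval z = ((s : Multiset T).map (fun t => (t.1 : ℂ) * z ^ (t.2 : ℕ))).sum := by
    intro z
    simp only [P]
    rw [← coe_evalRingHom, map_multiset_sum, Multiset.map_map]
    simp
  have hinj : Function.Injective (fun x : ℕ => ((x + 1 : ℕ) : ℂ)) := by
    intro a b hab
    simpa using hab
  have hP : P = (X ^ Mm - 1) ^ l.length := by
    apply Polynomial.eq_of_infinite_eval_eq
    apply (hinf.image hinj.injOn).mono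
    rintro _ ⟨x, hx, rfl⟩
    show P.eval _ = eval _ _
    have := tr x hx 1
    rw [pow_one, Hw_trace cs _ l hn ha] at this
    simp only [pow_one] at this
    rw [hPe, ← this]; simp
  intro m
  set j := 1 + Mm * m with hj
  have val : ∀ x ∈ S ⁻¹' {s}, (Hw cs (((x + 1 : ℕ) : ℂ) ^ Mm) l ^ j).trace =
      ((((x + 1 : ℕ) : ℂ) ^ Mm) ^ j - 1) ^ l.length := by
    intro x hx
    rw [tr x hx j]
    have h1 := hPe (((x + 1 : ℕ) : ℂ) ^ j)
    rw [hP] at h1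
    have h2 : (s : Multiset T).map (fun t => g (x + 1) t ^ j) =
        (s : Multiset T).map (fun t => (t.1 : ℂ) * (((x + 1 : ℕ) : ℂ) ^ j) ^ (t.2 : ℕ)) := by
      apply Multiset.map_congr rfl
      intro t _
      simp only [g]
      have h3 : (t.1 : ℂ) ^ j = t.1 := by rw [hj, pow_add, pow_mul, hT]; simp
      rw [mul_pow, h3, ← pow_mul, ← pow_mul, mul_comm j]
    rw [h2, ← h1]
    simp [← pow_mul, mul_comm]
  have poly : (Hw cs (X : ℂ[X]) l ^ j).trace = (X ^ j - 1) ^ l.length := by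
    apply Polynomial.eq_of_infinite_eval_eq
    have hinj2 : Function.Injective (fun x : ℕ => ((x + 1 : ℕ) : ℂ) ^ Mm) := by
      intro a b hab
      have : (a + 1) ^ Mm = (b + 1) ^ Mm := by
        have h5 : (((a + 1) ^ Mm : ℕ) : ℂ) = (((b + 1) ^ Mm : ℕ) : ℂ) := by
          push_cast; simpa using hab
        exact_mod_cast h5
      have := Nat.pow_left_injective hMm1.ne' this
      omega
    apply (hinf.image hinj2.injOn).mono
    rintro _ ⟨x, hx, rfl⟩
    show eval _ _ = eval _ _
    have e1 := Hw_map (evalRingHom (((x + 1 : ℕ) : ℂ) ^ Mm)) cs X l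
    have e2 := val x hx
    rw [coe_evalRingHom, eval_X] at e1
    rw [← e1, ← map_pow, ← map_tr, coe_evalRingHom] at e2
    rw [e2]; simp
  intro q
  have e1 := Hw_map (evalRingHom (q : ℂ)) cs X l
  have e2 := Hw_map Complex.ofRealHom cs q l
  rw [coe_evalRingHom, eval_X] at e1
  have e3 := congrArg (eval (q : ℂ)) poly
  rw [← coe_evalRingHom, map_tr, map_pow, e1] at e3
  apply Complex.ofReal_injective
  rw [← Complex.ofRealHom_eq_coe, ← Complex.ofRealHom_eq_coe, map_tr, map_pow, e2,
    Complex.ofRealHom_eq_coe, e3]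
  simp
end tr
end CoxFac

namespace CoxFac
set_option linter.unusedSectionVars false
section lim
open Filter Topology Asymptotics
variable {E : Type*} [NormedRing E] [NormOneClass E] [NormedAlgebra ℝ E] [CompleteSpace E]

theorem pow_sub_bound (X Y : E) (r : ℝ) (hr : 1 ≤ r) (hX : ‖X‖ ≤ r) (hY : ‖Y‖ ≤ r) (k : ℕ) :
    ‖X ^ k - Y ^ k‖ ≤ k * r ^ k * ‖X - Y‖ := by
  induction k with
  | zero => simp
  | succ k ih =>
    have e : X ^ (k+1) - Y ^ (k+1) = X * (X ^ k - Y ^ k) + (X - Y) * Y ^ k := by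
      rw [pow_succ', pow_succ']; noncomm_ring
    have h1 : ‖X * (X ^ k - Y ^ k)‖ ≤ r * (k * r ^ k * ‖X - Y‖) :=
      (norm_mul_le _ _).trans (by gcongr)
    have h3 : ‖Y ^ k‖ ≤ r ^ (k+1) := (norm_pow_le _ _).trans
      ((pow_le_pow_left₀ (norm_nonneg _) hY k).trans (pow_le_pow_right₀ hr (Nat.le_succ k)))
    have h2 : ‖(X - Y) * Y ^ k‖ ≤ ‖X - Y‖ * r ^ (k+1) :=
      (norm_mul_le _ _).trans (by gcongr)
    rw [e]
    refine (norm_add_le _ _).trans ((add_le_add h1 h2).trans (le_of_eq ?_))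
    push_cast; ring

theorem deriv_bound {F : ℝ → E} {D : E} (h : HasDerivAt F D 0) (h0 : F 0 = 1) :
    ∃ C : ℝ, 0 ≤ C ∧ ∀ᶠ x in 𝓝 (0:ℝ), ‖F x‖ ≤ Real.exp (C * |x|) := by
  obtain ⟨C, hC, hb⟩ := (h.isBigO_sub).exists_nonneg
  refine ⟨C, hC, hb.bound.mono fun x hx => ?_⟩
  rw [h0, sub_zero, Real.norm_eq_abs] at hx
  have : ‖F x‖ ≤ C * |x| + 1 := by
    calc ‖F x‖ = ‖(F x - 1) + 1‖ := by rw [sub_add_cancel]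
      _ ≤ _ := (norm_add_le _ _).trans (by rw [norm_one]; gcongr)
  exact this.trans (Real.add_one_le_exp _)

theorem exp_limit {F : ℝ → E} {D : E} (h : HasDerivAt F D 0) (h0 : F 0 = 1) (τ : ℝ) :
    Tendsto (fun k : ℕ => F (τ / k) ^ k) atTop (𝓝 (NormedSpace.exp (τ • D))) := by
  set G : ℝ → E := fun x => NormedSpace.exp (x • D) with hG
  have hGd : HasDerivAt G D 0 := by
    have := hasDerivAt_exp_smul_const (𝕂 := ℝ) D (0:ℝ)
    simpa using this
  have hG0 : G 0 = 1 := by simp [hG]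
  obtain ⟨C₁, hC₁, b₁⟩ := deriv_bound h h0
  obtain ⟨C₂, hC₂, b₂⟩ := deriv_bound hGd hG0
  have hx : Tendsto (fun k : ℕ => τ / (k:ℝ)) atTop (𝓝 0) := tendsto_const_div_atTop_nhds_zero_nat τ
  set C := max C₁ C₂
  have hd : (fun x => F x - G x) =o[𝓝 0] fun x => x := by
    have := (h.sub hGd).isLittleO
    simpa [h0, hG0] using this
  have hd' := hd.comp_tendsto hx
  have hz : Tendsto (fun k : ℕ => F (τ / k) ^ k - G (τ / k) ^ k) atTop (𝓝 0) := by
    have key : ∀ᶠ k : ℕ in atTop, ‖F (τ / k) ^ k - G (τ / k) ^ k‖ ≤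
        Real.exp (C * |τ|) * (k * ‖F (τ / k) - G (τ / k)‖) := by
      filter_upwards [hx.eventually b₁, hx.eventually b₂, eventually_gt_atTop 0] with k h1 h2 hk
      have hk' : (0:ℝ) < k := by exact_mod_cast hk
      have := pow_sub_bound (F (τ / k)) (G (τ / k)) (Real.exp (C * |τ / k|))
        (Real.one_le_exp (by positivity))
        (h1.trans (Real.exp_le_exp.2 (by gcongr; exact le_max_left _ _)))
        (h2.trans (Real.exp_le_exp.2 (by gcongr; exact le_max_right _ _))) k
      have e : Real.exp (C * |τ / k|) ^ k = Real.exp (C * |τ|) := by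
        rw [← Real.exp_nat_mul, abs_div, abs_of_pos hk']; congr 1; field_simp
      rw [e] at this
      calc _ ≤ _ := this
        _ = _ := by ring
    refine squeeze_zero_norm' key ?_
    have : Tendsto (fun k : ℕ => (k:ℝ) * ‖F (τ / k) - G (τ / k)‖) atTop (𝓝 0) := by
      have h1 : (fun k : ℕ => ‖F (τ / k) - G (τ / k)‖) =o[atTop] fun k : ℕ => τ / (k:ℝ) := hd'.norm_left
      have h2 := (isBigO_refl (fun k : ℕ => (k:ℝ)) atTop).mul_isLittleO h1
      have h3 : (fun k : ℕ => (k:ℝ) * (τ / k)) =O[atTop] fun _ => (1:ℝ) := by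
        apply IsBigO.of_bound |τ|
        filter_upwards [eventually_gt_atTop 0] with k hk
        have hk' : (k:ℝ) ≠ 0 := by exact_mod_cast hk.ne'
        rw [mul_div_cancel₀ _ hk']; simp
      exact (isLittleO_one_iff ℝ).1 (h2.trans_isBigO h3)
    simpa using this.const_mul (Real.exp (C * |τ|))
  have hGk : ∀ᶠ k : ℕ in atTop, G (τ / k) ^ k = NormedSpace.exp (τ • D) := by
    filter_upwards [eventually_gt_atTop 0] with k hk
    have hk' : (k:ℝ) ≠ 0 := by exact_mod_cast hk.ne'
    simp only [hG]
    let _ : NormedAlgebra ℚ E := NormedAlgebra.restrictScalars ℚ ℝ E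
    rw [← NormedSpace.exp_nsmul, ← Nat.cast_smul_eq_nsmul ℝ, smul_smul, mul_div_cancel₀ _ hk']
  have h5 : Tendsto (fun k : ℕ => G (τ / k) ^ k) atTop (𝓝 (NormedSpace.exp (τ • D))) :=
    tendsto_const_nhds.congr' (hGk.mono fun k hk => hk.symm)
  simpa using hz.add h5
end lim
end CoxFac

namespace CoxFac
set_option linter.unusedSectionVars false
section perm
open Filter Topology
open scoped Matrix.Norms.Operator
variable {B W : Type*} [Group W] [Fintype W] [DecidableEq W] {M : CoxeterMatrix B}

/-- left regular permutation matrices -/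
noncomputable def Pm : W →* Matrix W W ℝ where
  toFun g := Matrix.of fun v w => if v = g * w then 1 else 0
  map_one' := by ext v w; simp [Matrix.one_apply]
  map_mul' g h := by
    ext v w
    rw [Matrix.mul_apply]
    simp [mul_assoc, Matrix.of_apply]

theorem Pm_apply (g v w : W) : (Pm g : Matrix W W ℝ) v w = if v = g * w then 1 else 0 := rfl

theorem Pm_trace (g : W) : (Pm g : Matrix W W ℝ).trace = if g = 1 then (Fintype.card W : ℝ) else 0 := by
  simp only [Matrix.trace, Matrix.diag, Pm_apply, right_eq_mul]
  split_ifs <;> simp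

theorem Hs_one (cs : CoxeterSystem M W) (s : B) : Hs cs (1:ℝ) s = Pm (cs.simple s) := by
  ext v w
  have : (w = cs.simple s * v) ↔ v = cs.simple s * w := by
    constructor <;> (rintro rfl; simp)
  simp [Hs, Pm_apply, ca, cb, this]

theorem Hw_one (cs : CoxeterSystem M W) (ω : List B) : Hw cs (1:ℝ) ω = Pm (cs.wordProd ω) := by
  induction ω with
  | nil => simp [Hw]
  | cons s ω ih => rw [Hw_cons, ih, Hs_one, cs.wordProd_cons, map_mul]

/-- derivative of generator -/
noncomputable def Ds (cs : CoxeterSystem M W) (s : B) : Matrix W W ℝ := Hs cs 2 s - Hs cs 1 s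

theorem Hs_affine (cs : CoxeterSystem M W) (q : ℝ) (s : B) :
    Hs cs q s = Hs cs 1 s + (q - 1) • Ds cs s := by
  ext v w
  simp only [Hs, Ds, ca, cb, Matrix.add_apply, Matrix.smul_apply, Matrix.sub_apply, smul_eq_mul]
  split_ifs <;> ring

theorem Hs_deriv (cs : CoxeterSystem M W) (s : B) :
    HasDerivAt (fun q : ℝ => Hs cs q s) (Ds cs s) 1 := by
  have h : HasDerivAt (fun q : ℝ => Hs cs 1 s + (q - 1) • Ds cs s) ((1:ℝ) • Ds cs s) 1 :=
    (((hasDerivAt_id (1:ℝ)).sub_const 1).smul_const (Ds cs s)).const_add _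
  rw [one_smul] at h
  refine h.congr_of_eventuallyEq (Eventually.of_forall fun q => Hs_affine cs q s)

theorem Ds_rel (cs : CoxeterSystem M W) (s : B) :
    Ds cs s * Pm (cs.simple s) + Pm (cs.simple s) * Ds cs s = Pm (cs.simple s) + 1 := by
  have h1 := (Hs_deriv cs s).mul (Hs_deriv cs s)
  have h2 : HasDerivAt (fun q : ℝ => (q - 1) • Hs cs q s + q • (1 : Matrix W W ℝ))
      (((1:ℝ) - 1) • Ds cs s + (1:ℝ) • Hs cs 1 s + (1:ℝ) • (1 : Matrix W W ℝ)) 1 :=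
    (((hasDerivAt_id (1:ℝ)).sub_const 1).smul (Hs_deriv cs s)).add
      ((hasDerivAt_id (1:ℝ)).smul_const 1)
  have h3 := h1.unique (h2.congr_of_eventuallyEq (Eventually.of_forall fun q => Hs_quad cs q s))
  rw [Hs_one] at h3
  rw [h3]; simp

theorem Z_deriv (cs : CoxeterSystem M W) (ω : List B) :
    Hw cs (1:ℝ) ω * Hw cs 1 ω.reverse = 1 ∧
    HasDerivAt (fun q : ℝ => Hw cs q ω * Hw cs q ω.reverse)
      ((cs.leftInvSeq ω).map fun r => Pm r + 1).sum 1 := by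
  constructor
  · rw [Hw_one, Hw_one, ← map_mul, cs.wordProd_reverse]; simp
  induction ω with
  | nil => 
    simp only [Hw, List.map_nil, List.reverse_nil, List.prod_nil, mul_one,
      CoxeterSystem.leftInvSeq, List.sum_nil]
    exact hasDerivAt_const (1:ℝ) (1 : Matrix W W ℝ)
  | cons s ω ih =>
    have e : ∀ q : ℝ, Hw cs q (s :: ω) * Hw cs q (s :: ω).reverse =
        Hs cs q s * (Hw cs q ω * Hw cs q ω.reverse) * Hs cs q s := by
      intro q
      have : Hw cs q [s] = Hs cs q s := by simp [Hw]
      rw [List.reverse_cons, Hw_append, this, Hw_cons]; simp only [mul_assoc]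
    have e1 : Hw cs (1:ℝ) ω * Hw cs 1 ω.reverse = 1 := by
      rw [Hw_one, Hw_one, ← map_mul, cs.wordProd_reverse]; simp
    have h := ((Hs_deriv cs s).mul ih).mul (Hs_deriv cs s)
    refine (h.congr_of_eventuallyEq (Eventually.of_forall e)).congr_deriv ?_
    have ps : (Pm (cs.simple s) : Matrix W W ℝ) * Pm (cs.simple s) = 1 := by
      rw [← map_mul]; simp
    simp only [Pi.mul_apply]
    rw [e1, Hs_one, mul_one, mul_one, CoxeterSystem.leftInvSeq, List.map_cons, List.sum_cons, add_mul]
    have : ((List.map (MulAut.conj (cs.simple s)) (cs.leftInvSeq ω)).map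
        fun r => (Pm r + 1 : Matrix W W ℝ)).sum =
        Pm (cs.simple s) * ((cs.leftInvSeq ω).map fun r => (Pm r + 1 : Matrix W W ℝ)).sum * Pm (cs.simple s) := by
      rw [← List.sum_map_mul_left, ← List.sum_map_mul_right, List.map_map]
      congr 1
      apply List.map_congr_left
      intro r _
      simp [mul_add, add_mul, ps]
    rw [this, ← Ds_rel]
    abel

open Classical in
/-- sum of reflections -/
noncomputable def Am (cs : CoxeterSystem M W) : Matrix W W ℝ :=
  ∑ g : W, if cs.IsReflection g then Pm g else 0

theorem lis_sum (cs : CoxeterSystem M W) {ω : List B} (hr : cs.IsReduced ω)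
    (ht : IsTop cs (cs.wordProd ω)) :
    ((cs.leftInvSeq ω).map fun r => (Pm r + 1 : Matrix W W ℝ)).sum =
      Am cs + (ω.length : ℝ) • 1 := by
  classical
  have h1 : ((cs.leftInvSeq ω).map fun r => (Pm r + 1 : Matrix W W ℝ)).sum =
      ∑ r ∈ (cs.leftInvSeq ω).toFinset, (Pm r + 1) := by
    rw [List.sum_toFinset _ hr.nodup_leftInvSeq]
  have h2 : (cs.leftInvSeq ω).toFinset = Finset.univ.filter fun g => cs.IsReflection g := by
    ext g
    simp only [List.mem_toFinset, Finset.mem_filter, Finset.mem_univ, true_and]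
    exact ⟨fun h => cs.isReflection_of_mem_leftInvSeq ω h, fun h => mem_lis_top cs ht h⟩
  have h3 : (cs.leftInvSeq ω).toFinset.card = ω.length := by
    rw [List.toFinset_card_of_nodup hr.nodup_leftInvSeq, cs.length_leftInvSeq]
  rw [h1, Finset.sum_add_distrib, Finset.sum_const, h3, h2, Finset.sum_filter, Am,
    Nat.cast_smul_eq_nsmul]

theorem Am_comm (cs : CoxeterSystem M W) (y : W) : Commute (Pm y) (Am cs) := by
  classical
  have : Pm y * Am cs * Pm y⁻¹ = Am cs := by
    rw [Am, Finset.mul_sum, Finset.sum_mul]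
    refine Fintype.sum_equiv (MulAut.conj y).toEquiv _ _ fun g => ?_
    have := cs.isReflection_conj_iff y g
    simp only [MulEquiv.toEquiv_eq_coe, EquivLike.coe_coe, MulAut.conj_apply, this]
    split_ifs <;> simp
  have e : (Pm y⁻¹ : Matrix W W ℝ) * Pm y = 1 := by rw [← map_mul]; simp
  calc Pm y * Am cs = Pm y * Am cs * (Pm y⁻¹ * Pm y) := by rw [e, mul_one]
    _ = _ := by rw [← mul_assoc, this]

open Classical in
theorem Am_pow (cs : CoxeterSystem M W) (l : ℕ) : Am cs ^ l =
    ∑ f : Fin l → W, if (∀ k, cs.IsReflection (f k)) then Pm (List.ofFn f).prod else 0 := by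
  induction l with
  | zero => simp
  | succ l ih =>
    rw [pow_succ', ih, Am, Finset.sum_mul_sum, ← Finset.sum_product',
      ← (Fin.consEquiv fun _ : Fin (l+1) => W).sum_comp]
    refine Finset.sum_congr rfl fun p _ => ?_
    simp only [Fin.consEquiv_apply, Fin.forall_fin_succ, Fin.cons_zero, Fin.cons_succ,
      List.ofFn_succ, List.prod_cons, map_mul]
    split_ifs <;> simp_all

theorem count (cs : CoxeterSystem M W) (l : ℕ) (x c : W) (hx : IsConj x⁻¹ c) :
    (Pm x * Am cs ^ l).trace = (Fintype.card W : ℝ) * (Nat.card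
      {f : Fin l → W // (∀ k, cs.IsReflection (f k)) ∧ (List.ofFn f).prod = c} : ℝ) := by
  classical
  obtain ⟨y, hy⟩ := isConj_iff.1 hx
  have h1 : (Pm x * Am cs ^ l).trace = (Pm c⁻¹ * Am cs ^ l).trace := by
    have : c⁻¹ = y * x * y⁻¹ := by rw [← hy]; group
    rw [this, map_mul, mul_assoc, ((Am_comm cs y⁻¹).pow_right l).eq, ← mul_assoc,
      Matrix.trace_mul_comm (Pm (y * x) * Am cs ^ l), ← mul_assoc, ← map_mul]
    congr 3; group
  rw [h1, Am_pow, Finset.mul_sum, Matrix.trace_sum, Nat.card_eq_fintype_card, Fintype.card_subtype,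
    Finset.card_filter]
  push_cast
  rw [Finset.mul_sum]
  refine Finset.sum_congr rfl fun f _ => ?_
  by_cases h : ∀ k, cs.IsReflection (f k)
  · simp only [h, implies_true, if_true, true_and, ← map_mul, Pm_trace, inv_mul_eq_one, mul_ite, mul_one, mul_zero]
    simp only [eq_comm]
  · simp [h]

theorem trace_exp (cs : CoxeterSystem M W) {l ω ω' : List B} {h : ℕ} (hh : 1 ≤ h)
    (hn : l.Nodup) (ha : ∀ i, i ∈ l)
    (hr : cs.IsReduced ω) (hr' : cs.IsReduced ω') (ht : IsTop cs (cs.wordProd ω))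
    (ht' : IsTop cs (cs.wordProd ω')) (he : ω ++ ω' = (List.replicate h l).flatten) (τ : ℝ) :
    (Pm (cs.wordProd l) * NormedSpace.exp (τ • (Am cs + (ω.length : ℝ) • 1))).trace =
      (Real.exp (h * τ) - 1) ^ l.length := by
  obtain ⟨m0, hm0, H⟩ := trace_formula cs hh hn ha hr hr' ht ht' he
  set F : ℝ → Matrix W W ℝ := fun x => Hw cs (Real.exp x) ω * Hw cs (Real.exp x) ω.reverse with hF
  have hF0 : F 0 = 1 := by simp only [hF, Real.exp_zero]; exact (Z_deriv cs ω).1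
  have hFd : HasDerivAt F (Am cs + (ω.length : ℝ) • 1) 0 := by
    have h1 := (Z_deriv cs ω).2
    rw [lis_sum cs hr ht] at h1
    have h2 := Real.hasDerivAt_exp 0
    rw [Real.exp_zero] at h2
    have := HasDerivAt.scomp_of_eq (0:ℝ) h1 h2 (by simp)
    simp only [one_smul] at this
    exact this
  have hFq : ∀ x, F x = Hw cs (Real.exp x) l ^ h := by
    intro x
    rw [← Hw_flatten, ← he, Hw_append, hF]
    simp only
    rw [Hw_eq cs _ (hr.reverse) hr']
    rw [cs.wordProd_reverse, IsTop.inv cs ht]; exact ht.eq cs ht'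
  have L1 := exp_limit hFd hF0 τ
  have hk : Tendsto (fun m : ℕ => m0 * m) atTop atTop :=
    tendsto_id.const_mul_atTop' hm0
  have L2 := L1.comp hk
  have hx : Tendsto (fun k : ℕ => τ / (k:ℝ)) atTop (𝓝 0) := tendsto_const_div_atTop_nhds_zero_nat τ
  have hx' := hx.comp hk
  have hc : Continuous fun x : ℝ => Hw cs (Real.exp x) l := by
    have : ∀ l : List B, Continuous fun x : ℝ => Hw cs (Real.exp x) l := by
      intro l
      induction l with
      | nil => simpa [Hw] using continuous_const
      | cons s l ih =>
        simp only [Hw_cons]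
        refine Continuous.mul ?_ ih
        simp only [Hs_affine cs (Real.exp _) s]
        fun_prop
    exact this l
  have L3 : Tendsto (fun m : ℕ => Hw cs (Real.exp (τ / ((m0 * m : ℕ):ℝ))) l) atTop
      (𝓝 (Pm (cs.wordProd l))) := by
    have := (hc.tendsto 0).comp hx'
    rw [Real.exp_zero, Hw_one] at this
    exact this
  have L4 := ((continuous_id.matrix_trace).tendsto _).comp (L3.mul L2)
  have L5 : Tendsto (fun m : ℕ => (Real.exp (τ / ((m0 * m : ℕ):ℝ)) * Real.exp (h * τ) - 1) ^ l.length) atTop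
      (𝓝 ((Real.exp (h * τ) - 1) ^ l.length)) := by
    have := (Real.continuous_exp.tendsto 0).comp hx'
    rw [Real.exp_zero] at this
    have := ((this.mul_const (Real.exp (h * τ))).sub_const 1).pow l.length
    rw [one_mul] at this
    exact this
  refine tendsto_nhds_unique (L4.congr' ?_) L5
  filter_upwards [eventually_gt_atTop 0] with m hm
  have hkm : ((m0 * m : ℕ) : ℝ) ≠ 0 := by
    have : 0 < m0 * m := Nat.mul_pos hm0 hm
    exact_mod_cast this.ne'
  have := H m (Real.exp (τ / ((m0 * m : ℕ):ℝ)))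
  have e2 : Real.exp (τ / ((m0 * m : ℕ):ℝ)) ^ (h * (m0 * m)) = Real.exp (h * τ) := by
    rw [← Real.exp_nat_mul, Nat.cast_mul h, mul_assoc, mul_div_cancel₀ _ hkm]
  rw [mul_assoc h, pow_add, pow_one, pow_add, pow_one, e2, pow_mul, ← hFq] at this
  exact this
end perm
end CoxFac

namespace CoxFac
section fin
open Filter Topology
open scoped Matrix.Norms.Operator
variable {B W : Type*} [Group W] [Fintype W] [DecidableEq W] {M : CoxeterMatrix B}

theorem exp_shift_aux {E : Type*} [NormedRing E] [NormedAlgebra ℝ E] [CompleteSpace E]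
    (A : E) (τ L : ℝ) :
    NormedSpace.exp (τ • (A + L • 1)) = Real.exp (τ * L) • NormedSpace.exp (τ • A) := by
  let _ : NormedAlgebra ℚ E := NormedAlgebra.restrictScalars ℚ ℝ _
  have e : τ • (A + L • (1 : E)) = algebraMap ℝ _ (τ * L) + τ • A := by
    rw [smul_add, smul_smul, Algebra.algebraMap_eq_smul_one, add_comm]
  rw [e, NormedSpace.exp_add_of_commute (Algebra.commutes _ _), ← NormedSpace.algebraMap_exp_comm,
    ← Algebra.smul_def, Real.exp_eq_exp_ℝ]

theorem exp_shift (A : Matrix W W ℝ) (τ L : ℝ) :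
    NormedSpace.exp (τ • (A + L • 1)) = Real.exp (τ * L) • NormedSpace.exp (τ • A) :=
  exp_shift_aux A τ L

theorem hasSum_trace (x A : Matrix W W ℝ) (τ : ℝ) :
    HasSum (fun l : ℕ => τ ^ l / l.factorial * (x * A ^ l).trace)
      (x * NormedSpace.exp (τ • A)).trace := by
  have h := NormedSpace.exp_series_hasSum_exp' (𝕂 := ℝ) (τ • A)
  have h2 := (h.mul_left x).map (Matrix.traceAddMonoidHom W ℝ) (continuous_id.matrix_trace)
  have e : (fun l : ℕ => τ ^ l / l.factorial * (x * A ^ l).trace) =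
      (Matrix.traceAddMonoidHom W ℝ) ∘ fun l : ℕ => x * ((l.factorial⁻¹ : ℝ) • (τ • A) ^ l) := by
    funext l
    simp only [Function.comp, Matrix.traceAddMonoidHom_apply]
    rw [smul_pow, smul_smul, Matrix.mul_smul, Matrix.trace_smul, smul_eq_mul]
    ring
  rw [e]
  exact h2
end fin
end CoxFac

theorem stmt_9 {W : Type*} [Group W] [Finite W] (n : ℕ) (hn : 1 ≤ n)
    (M : CoxeterMatrix (Fin n)) (cs : CoxeterSystem M W)
    (hirr : ¬ ∃ P : Set (Fin n), P.Nonempty ∧ Pᶜ.Nonempty ∧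
      ∀ i ∈ P, ∀ j ∈ Pᶜ, Commute (cs.simple i) (cs.simple j))
    (σ : Equiv.Perm (Fin n)) (c : W) (hc : c = (List.ofFn fun k => cs.simple (σ k)).prod)
    (N : ℕ → ℕ)
    (hN : ∀ l : ℕ, N l = Nat.card
      {f : Fin l → W // (∀ k, cs.IsReflection (f k)) ∧ (List.ofFn f).prod = c})
    (nR : ℕ) (hnR : nR = Nat.card {w : W // cs.IsReflection w}) :
    ∀ t : ℝ,
      Summable (fun l : ℕ => |t ^ l / l.factorial * (N l : ℝ)|) ∧
      ∑' l : ℕ, t ^ l / l.factorial * (N l : ℝ) =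
        (1 / (Nat.card W : ℝ)) *
          (Real.exp (t * nR / n) - Real.exp (-(t * nR) / n)) ^ n := by
  classical
  intro t
  have : Nonempty (Fin n) := ⟨⟨0, hn⟩⟩
  let _ : Fintype W := Fintype.ofFinite W
  obtain ⟨l, h, ω, ω', hl, ha, hh, hr, hr', ht, ht', he⟩ := CoxFac.exists_alternating cs hirr
  have len : l.length = n := by
    have : l.toFinset = Finset.univ := by ext; simp [ha]
    rw [← List.toFinset_card_of_nodup hl, this]; simp
  have e1 : nR = ω.length := by rw [hnR, CoxFac.top_length cs hr ht]
  have e2 : nR = ω'.length := by rw [hnR, CoxFac.top_length cs hr' ht']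
  have e3 : (2 * nR : ℝ) = h * n := by
    have := congrArg List.length he
    rw [List.length_append, ← e1, ← e2, List.length_flatten, List.map_replicate,
      List.sum_replicate, len, smul_eq_mul] at this
    rw [two_mul]
    exact_mod_cast this
  have hconj : IsConj (cs.wordProd l)⁻¹ c := by
    have h1 : c = cs.wordProd (List.ofFn σ) := by
      rw [hc, CoxeterSystem.wordProd, List.map_ofFn]; rfl
    rw [h1, ← cs.wordProd_reverse]
    apply CoxFac.coxeter_conj cs
    · simpa using hl
    · rw [List.nodup_ofFn]; exact σ.injective
    · simpa using ha
    · intro i; rw [List.mem_ofFn]; exact σ.surjective i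
  have T := CoxFac.trace_exp cs hh hl ha hr hr' ht ht' he t
  rw [CoxFac.exp_shift, ← e1, len, Matrix.mul_smul, Matrix.trace_smul, smul_eq_mul] at T
  have S := CoxFac.hasSum_trace (CoxFac.Pm (cs.wordProd l)) (CoxFac.Am cs) t
  have hW : (Fintype.card W : ℝ) ≠ 0 := by exact_mod_cast Fintype.card_ne_zero
  have hn0 : (n : ℝ) ≠ 0 := by positivity
  have S2 := S.mul_left (1 / (Nat.card W : ℝ))
  have S3 : HasSum (fun l : ℕ => t ^ l / l.factorial * (N l : ℝ)) ((1 / (Nat.card W : ℝ)) *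
          (Real.exp (t * nR / n) - Real.exp (-(t * nR) / n)) ^ n) := by
    have g1 : (fun l : ℕ => t ^ l / l.factorial * (N l : ℝ)) = fun i => 1 / (Nat.card W : ℝ) *
        (t ^ i / i.factorial * (CoxFac.Pm (cs.wordProd l) * CoxFac.Am cs ^ i).trace) := by
      funext k
      rw [CoxFac.count cs k _ c hconj, ← hN, Nat.card_eq_fintype_card]
      field_simp
    have g2 : (Real.exp (t * nR / n) - Real.exp (-(t * nR) / n)) ^ n =
        (CoxFac.Pm (cs.wordProd l) * NormedSpace.exp (t • CoxFac.Am cs)).trace := by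
      have p : Real.exp (t * nR) ≠ 0 := (Real.exp_pos _).ne'
      apply mul_left_cancel₀ p
      rw [T]
      have q1 : Real.exp (t * nR) = Real.exp (t * nR / n) ^ n := by
        rw [← Real.exp_nat_mul, mul_div_cancel₀ _ hn0]
      rw [q1, ← mul_pow, mul_sub, ← Real.exp_add, ← Real.exp_add]
      congr 2
      · congr 1
        field_simp
        linear_combination t * e3
      · rw [← Real.exp_zero]; congr 1; ring
    rw [g1, g2]
    exact S2
  exact ⟨summable_abs_iff.2 S3.summable, S3.tsum_eq⟩
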